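/- **Architecture.** Let $L\ge1$. For $0\le l\le L$ the layer-$l$ activations are $x\in\mathbb R^{U_l\times w_l}$ ($U_l$ channels, $w_l$ spatial positions), and patches $S^{l,1},\dots,S^{l,O_l}$ are given, each an ordered list of $d_{l+1}$ positions in $\{1,\dots,U_l\}\times\{1,\dots,w_l\}$. For $1\le l\le L$ a filter matrix $A^l\in\mathbb R^{m_l\times d_l}$ acts by $\Lambda_{A^l}(x)_{j,o}=\sum_{i=1}^{d_l}x_{S^{l-1,o}_i}A^l_{j,i}$ ($j\le m_l$, $o\le O_{l-1}$), and $G_l:\mathbb R^{m_l\times O_{l-1}}\to\mathbb R^{U_l\times w_l}$ is a fixed nonlinearity. For $\mathcal A=(A^1,\dots,A^L)$ put $F^{l_1\to l_2}=G_{l_2}\circ\Lambda_{A^{l_2}}\circ\dots\circ G_{l_1+1}\circ\Lambda_{A^{l_1+1}}$ and $F_{\mathcal A}=F^{0\to L}$. On layer-$l$ activations let $$|x|_l=\max_{o\le O_l}\Big(\sum_{i}x_{S^{l,o}_i}^2\Big)^{1/2},\qquad |x|_{\infty,l}=\max_{v\le w_l}\Big(\sum_{u\le U_l}x_{u,v}^2\Big)^{1/2}.$$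 Let $\rho^{\mathcal A}_{l_1\to l_2}$ be the Lipschitz constant of $F^{l_1\to l_2}$ with respect to $|\cdot|_{\infty,l_1}$ and $|\cdot|_{l_2}$, let $\|A^\top\|_{2,1}$ be the sum of the Euclidean norms of the rows of $A$, and let $\bar W=\max_{1\le l\le L}O_{l-1}m_l$. **Assumptions on the architecture.** The output layer consists of the scores of $K\ge2$ classes: $U_L=K$, $w_L=1$ (for instance, a fully connected last layer of width $K$). Each score belongs to at least one of the patches $S^{L,o}$ (for instance, the patches are the singletons, and $|\cdot|_L$ is the sup norm of the score vector). For all $1\le l\le L$ and all $z,z'$, $$|G_l(z)-G_l(z')|_{\infty,l}\le\Big(\sum_{j\le m_l}\max_{o\le O_{l-1}}|z_{j,o}-z'_{j,o}|^2\Big)^{1/2}.$$ (This holds for ReLU combined with spatial max pooling, and more generally whenever $U_l=m_l$ and each output channel is a function of the corresponding input channel alone that is $1$-Lipschitz for the $\ell^\infty$ norms; it also holds if $G_l$ is $1$-Lipschitz for the norms given by the maximum over positions of the $\ell^2$ norm across channels.) **Theorem.** Let $(x_1,y_1),\dots,(x_n,y_n)$, $n\ge1$, be i.i.d. copies of a random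 pair $(x,y)\in\mathbb R^{U_0\times w_0}\times\{1,\dots,K\}$, and fix $a_1,\dots,a_L>0$, $b_0,b_1,\dots,b_L>0$ with $b_L=\gamma$, and $\rho_{l_1\to l_2}>0$ for $1\le l_1\le l_2\le L$. Suppose $|x|_0\le b_0$ almost surely. Then for any $\delta>0$, with probability at least $1-\delta$ over the training set, every $\mathcal A=(A^1,\dots,A^L)$ with $\|(A^l)^\top\|_{2,1}\le a_l$ for all $1\le l\le L$ and $\rho^{\mathcal A}_{l_1\to l_2}\le\rho_{l_1\to l_2}$ for all $1\le l_1\le l_2\le L$ satisfies $$\mathbb P\big(\operatorname{argmax}_jF_{\mathcal A}(x)_j\ne y\big)\le\frac{n-\#I}{n}+\frac8n+\frac{1536}{\sqrt n}\,R\,\big[\log_2(32\Gamma n^2+7\bar Wn)\big]^{1/2}\log n+3\sqrt{\frac{\log(2/\delta)}{2n}},$$ where a tie for the maximal score counts as an error on the left, and $$I=\Big\{i\le n:\ F_{\mathcal A}(x_i)_{y_i}-\max_{j\ne y_i}F_{\mathcal A}(x_i)_j>\gamma\ \text{ and }\ |F^{0\to l}(x_i)|_l\le b_l\ \text{ for all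 }0\le l\le L\Big\},$$ $$R^{2/3}=\sum_{l=1}^L(a_lb_{l-1}\rho_{l+})^{2/3},\qquad\Gamma=\max_{1\le l\le L}b_{l-1}a_lO_{l-1}m_l\rho_{l+},\qquad\rho_{l+}=\max_{l\le i\le L}\frac{\rho_{l\to i}}{b_i}.$$ -/

import Mathlib

open MeasureTheory
open scoped ENNReal NNReal

/-- A convolutional feedforward architecture.  `U l` and `w l` are the numbers of channels and of
spatial positions of the layer-`l` activations; `O l` is the number of convolutional patches of the
layer-`l` activations, `d (l+1)` is their size, and `patch l o i` is the `i`-th element of the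
`o`-th patch; `m (l+1)` is the number of filters of the convolution from layer `l` to layer `l+1`;
`G l` is the nonlinearity (activation and pooling) that turns the preactivations of layer `l+1`
into the activations of layer `l+1`.  A network of depth `L` uses the layers `0, …, L` only. -/
structure ConvNet where
  U : ℕ → ℕ
  w : ℕ → ℕ
  m : ℕ → ℕ
  d : ℕ → ℕ
  O : ℕ → ℕ
  patch : (l : ℕ) → Fin (O l) → Fin (d (l + 1)) → Fin (U l) × Fin (w l)
  G : (l : ℕ) → (Fin (m (l + 1)) → Fin (O l) → ℝ) → (Fin (U (l + 1)) → Fin (w (l + 1)) → ℝ)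

namespace ConvNet

variable (net : ConvNet)

/-- The layer-`l` activation space `ℝ^{U_l × w_l}`. -/
abbrev Act (l : ℕ) := Fin (net.U l) → Fin (net.w l) → ℝ

/-- The space `ℝ^{m_{l+1} × O_l}` of preactivations of layer `l+1`. -/
abbrev PreAct (l : ℕ) := Fin (net.m (l + 1)) → Fin (net.O l) → ℝ

/-- The space `ℝ^{m_{l+1} × d_{l+1}}` of filter matrices from layer `l` to layer `l+1`; the rows
are the filters. -/
abbrev Wt (l : ℕ) := Fin (net.m (l + 1)) → Fin (net.d (l + 1)) → ℝ

/-- The convolution operation `Λ_A`. -/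
def conv (l : ℕ) (A : net.Wt l) (x : net.Act l) : net.PreAct l :=
  fun j o => ∑ i, x (net.patch l o i).1 (net.patch l o i).2 * A j i

/-- One layer: convolution followed by the nonlinearity. -/
def layer (l : ℕ) (A : net.Wt l) (x : net.Act l) : net.Act (l + 1) :=
  net.G l (net.conv l A x)

/-- The network up to layer `l`, i.e. `F^{0→l}`.  The matrix `A l` is the filter matrix of
layer `l+1`. -/
def F (A : ∀ l, net.Wt l) : (l : ℕ) → net.Act 0 → net.Act l
  | 0 => id
  | l + 1 => fun x => net.layer l (A l) (F A l x)

/-- The subnetwork `F^{l₁→l₁+k}`. -/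
def sub (A : ∀ l, net.Wt l) (l₁ : ℕ) : (k : ℕ) → net.Act l₁ → net.Act (l₁ + k)
  | 0 => id
  | k + 1 => fun x => net.layer (l₁ + k) (A (l₁ + k)) (sub A l₁ k x)

/-- `|x|_l`: the maximum Euclidean norm of a convolutional patch of `x`. -/
noncomputable def patchNorm (l : ℕ) (x : net.Act l) : ℝ :=
  ⨆ o : Fin (net.O l), √(∑ i, (x (net.patch l o i).1 (net.patch l o i).2) ^ 2)

/-- `|x|_{∞,l}`: the maximum over spatial positions of the Euclidean norm across channels. -/
noncomputable def pixelNorm (l : ℕ) (x : net.Act l) : ℝ :=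
  ⨆ j : Fin (net.w l), √(∑ u, (x u j) ^ 2)

/-- The Euclidean norm, across the filters, of the channelwise spatial sup norms of a
preactivation. -/
noncomputable def channelNorm (l : ℕ) (z : net.PreAct l) : ℝ :=
  √(∑ j, (⨆ o : Fin (net.O l), |z j o|) ^ 2)

/-- `ρ^𝒜_{l₁→l₁+k}`: the Lipschitz constant of the subnetwork `F^{l₁→l₁+k}` with respect to
`|·|_{∞,l₁}` and `|·|_{l₁+k}`, i.e. the infimum of all its Lipschitz bounds (`∞` if there are
none). -/
noncomputable def lipConst (A : ∀ l, net.Wt l) (l₁ k : ℕ) : ℝ≥0∞ :=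
  ⨅ (c : ℝ≥0) (_ : ∀ x y : net.Act l₁,
    net.patchNorm (l₁ + k) (net.sub A l₁ k x - net.sub A l₁ k y) ≤ c * net.pixelNorm l₁ (x - y)),
    (c : ℝ≥0∞)

/-- `‖A^⊤‖_{2,1}`: the sum of the Euclidean norms of the rows of `A`. -/
noncomputable def norm21 (l : ℕ) (A : net.Wt l) : ℝ :=
  ∑ j, √(∑ i, (A j i) ^ 2)

/-- The class score `F_𝒜(x)_c`; the output layer `L` has a single spatial position. -/
def score (L : ℕ) (h : net.w L = 1) (A : ∀ l, net.Wt l) (x : net.Act 0) (c : Fin (net.U L)) : ℝ :=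
  net.F A L x c ⟨0, by omega⟩

/-- The event `argmax_j F_𝒜(x)_j ≠ y`: the label `y` is not the unique maximiser of the scores
(ties count as errors). -/
def misclassified (L : ℕ) (h : net.w L = 1) (A : ∀ l, net.Wt l) :
    Set (net.Act 0 × Fin (net.U L)) :=
  {p | ∃ c, c ≠ p.2 ∧ net.score L h A p.1 p.2 ≤ net.score L h A p.1 c}

/-- The margin `F_𝒜(x)_y - max_{j ≠ y} F_𝒜(x)_j`. -/
noncomputable def margin (L : ℕ) (h : net.w L = 1) (A : ∀ l, net.Wt l) (x : net.Act 0)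
    (y : Fin (net.U L)) : ℝ :=
  net.score L h A x y - ⨆ c : {c : Fin (net.U L) // c ≠ y}, net.score L h A x c

/-- The index set `I` of the sample points that have margin greater than `γ` and activations
bounded by `b`. -/
def goodSet (L : ℕ) (h : net.w L = 1) (A : ∀ l, net.Wt l) (b : ℕ → ℝ) (γ : ℝ) {n : ℕ}
    (s : Fin n → net.Act 0 × Fin (net.U L)) : Set (Fin n) :=
  {i | net.margin L h A (s i).1 (s i).2 > γ ∧
    ∀ l ≤ L, net.patchNorm l (net.F A l (s i).1) ≤ b l}

/-- `W̄ = max_{l=1}^L O_{l-1} m_l`: the maximum width before pooling. -/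
noncomputable def maxWidth (L : ℕ) : ℝ :=
  ⨆ l : Fin L, (net.O l : ℝ) * net.m (l + 1)

/-- `ρ_{l+} = max_{i=l}^L ρ_{l→i} / b_i`. -/
noncomputable def rhoPlus (L : ℕ) (ρ : ℕ → ℕ → ℝ) (b : ℕ → ℝ) (l : ℕ) : ℝ :=
  ⨆ i : Set.Icc l L, ρ l i / b i

/-- `R`, given by `R^{2/3} = ∑_{l=1}^L (a_l b_{l-1} ρ_{l+})^{2/3}`. -/
noncomputable def capacity (L : ℕ) (a b : ℕ → ℝ) (ρ : ℕ → ℕ → ℝ) : ℝ :=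
  (∑ l ∈ Finset.range L, (a (l + 1) * b l * rhoPlus L ρ b (l + 1)) ^ (2 / 3 : ℝ)) ^ (3 / 2 : ℝ)

/-- `Γ = max_{l=1}^L b_{l-1} a_l O_{l-1} m_l ρ_{l+}`. -/
noncomputable def gammaMax (L : ℕ) (a b : ℕ → ℝ) (ρ : ℕ → ℕ → ℝ) : ℝ :=
  ⨆ l : Fin L, b l * a (l + 1) * net.O l * net.m (l + 1) * rhoPlus L ρ b (l + 1)

end ConvNet

section Concentration

open ProbabilityTheory

variable {X : Type*} [MeasurableSpace X]

/-- Integrals against a product of `n + 1` copies of `μ`, one coordinate at a time. -/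
theorem integral_pi_succ (μ : Measure X) [IsProbabilityMeasure μ] (n : ℕ)
    (f : (Fin (n + 1) → X) → ℝ) (hf : Integrable f (Measure.pi fun _ => μ)) :
    ∫ s, f s ∂(Measure.pi fun _ => μ) =
      ∫ x, ∫ s, f (Fin.cons x s) ∂(Measure.pi fun _ : Fin n => μ) ∂μ := by
  have h := (measurePreserving_piFinSuccAbove (fun _ : Fin (n + 1) => μ) 0).symm
  rw [← h.integral_comp', integral_prod]
  · simp [MeasurableEquiv.piFinSuccAbove_symm_apply, Fin.insertNthEquiv]
  · exact (h.integrable_comp_emb (MeasurableEquiv.measurableEmbedding _)).2 hf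

theorem measurable_fin_cons {n : ℕ} :
    Measurable fun p : X × (Fin n → X) => (Fin.cons p.1 p.2 : Fin (n + 1) → X) := by
  refine measurable_pi_iff.2 fun i => ?_
  refine Fin.cases ?_ (fun j => ?_) i
  · simpa using measurable_fst
  · simp only [Fin.cons_succ]
    fun_prop

theorem integrable_of_abs_le {Ω : Type*} [MeasurableSpace Ω] {ν : Measure Ω} [IsFiniteMeasure ν]
    {f : Ω → ℝ} (hf : Measurable f) {M : ℝ} (hM : ∀ x, |f x| ≤ M) : Integrable f ν :=
  Integrable.of_bound hf.aestronglyMeasurable M (ae_of_all _ hM)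

/-- The exponential moment bound behind the bounded differences inequality. -/
theorem integral_exp_le_of_bounded_differences (μ : Measure X) [IsProbabilityMeasure μ] {c : ℝ}
    (t : ℝ) (n : ℕ) (φ : (Fin n → X) → ℝ) (hφ : Measurable φ) {M : ℝ} (hM : ∀ s, |φ s| ≤ M)
    (hc : ∀ s i x, φ s - φ (Function.update s i x) ≤ c) :
    ∫ s, Real.exp (t * (φ s - ∫ s', φ s' ∂(Measure.pi fun _ => μ))) ∂(Measure.pi fun _ => μ) ≤
      Real.exp (n * (c ^ 2 * t ^ 2 / 8)) := by
  induction n generalizing M with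
  | zero =>
    have : ∀ s, φ s = φ default := fun s => congrArg φ (Subsingleton.elim _ _)
    simp [this]
  | succ n ih =>
    set ν : Measure (Fin n → X) := Measure.pi fun _ => μ
    set ψ : X → ℝ := fun x => ∫ s, φ (Fin.cons x s) ∂ν with hψ
    have hφc : Measurable fun p : X × (Fin n → X) => φ (Fin.cons p.1 p.2) :=
      hφ.comp measurable_fin_cons
    have hφx : ∀ x, Measurable fun s : Fin n → X => φ (Fin.cons x s) := fun x =>
      hφc.comp measurable_prodMk_left
    have hφi : ∀ x, Integrable (fun s : Fin n → X => φ (Fin.cons x s)) ν := fun x =>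
      integrable_of_abs_le (hφx x) fun s => hM _
    have hψm : Measurable ψ :=
      (hφc.stronglyMeasurable.integral_prod_right' (ν := ν)).measurable
    have hψM : ∀ x, |ψ x| ≤ M := fun x => by
      have := norm_integral_le_of_norm_le_const (μ := ν) (f := fun s => φ (Fin.cons x s)) (C := M)
        (ae_of_all _ fun s => hM _)
      simpa using this
    have hE : ∫ s, φ s ∂(Measure.pi fun _ => μ) = ∫ x, ψ x ∂μ :=
      integral_pi_succ μ n φ (integrable_of_abs_le hφ hM)
    set m := ∫ x, ψ x ∂μ with hm
    have hψc : ∀ x y, ψ x - ψ y ≤ c := fun x y => by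
      rw [hψ]
      simp only
      rw [← integral_sub (hφi x) (hφi y)]
      calc _ ≤ ∫ _, c ∂ν := by
            refine integral_mono ((hφi x).sub (hφi y)) (integrable_const _) fun s => ?_
            have := hc (Fin.cons x s) 0 y
            rwa [Fin.update_cons_zero] at this
        _ = c := by simp
    have hmM : |m| ≤ M := by
      have := norm_integral_le_of_norm_le_const (μ := μ) (f := ψ) (C := M) (ae_of_all _ hψM)
      simpa using this
    rw [hE]
    have hexpM : ∀ s, |Real.exp (t * (φ s - m))| ≤ Real.exp (|t| * (2 * M)) := fun s => by
      rw [Real.abs_exp]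
      refine Real.exp_le_exp.2 ((le_abs_self _).trans ?_)
      rw [abs_mul]
      refine mul_le_mul_of_nonneg_left ?_ (abs_nonneg _)
      have := hM s
      rw [abs_le] at *
      constructor <;> linarith
    have hexpm : Measurable fun s => Real.exp (t * (φ s - m)) := by fun_prop
    rw [integral_pi_succ μ n _ (integrable_of_abs_le hexpm hexpM)]
    have hinner : ∀ x, ∫ s, Real.exp (t * (φ (Fin.cons x s) - m)) ∂ν ≤
        Real.exp (t * (ψ x - m)) * Real.exp (n * (c ^ 2 * t ^ 2 / 8)) := fun x => by
      have h := ih (fun s => φ (Fin.cons x s)) (hφx x) (fun s => hM _) fun s i y => by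
        have := hc (Fin.cons x s) i.succ y
        rwa [← Fin.cons_update] at this
      calc _ = ∫ s, Real.exp (t * (ψ x - m)) *
              Real.exp (t * (φ (Fin.cons x s) - ψ x)) ∂ν := by
            refine integral_congr_ae (ae_of_all _ fun s => ?_)
            simp only
            rw [← Real.exp_add]
            ring_nf
        _ = Real.exp (t * (ψ x - m)) * ∫ s, Real.exp (t * (φ (Fin.cons x s) - ψ x)) ∂ν :=
            integral_const_mul _ _
        _ ≤ _ := mul_le_mul_of_nonneg_left h (Real.exp_pos _).le
    obtain ⟨x₀⟩ : Nonempty X := nonempty_of_isProbabilityMeasure μ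
    have hbdd : BddBelow (Set.range ψ) := ⟨-M, by
      rintro _ ⟨x, rfl⟩
      exact (abs_le.1 (hψM x)).1⟩
    have : Nonempty X := ⟨x₀⟩
    have hIcc : ∀ x, ψ x ∈ Set.Icc (⨅ y, ψ y) ((⨅ y, ψ y) + c) := fun x =>
      ⟨ciInf_le hbdd x, by
        have : ψ x - c ≤ ⨅ y, ψ y := le_ciInf fun y => by linarith [hψc x y]
        linarith⟩
    have hH := hasSubgaussianMGF_of_mem_Icc (μ := μ) hψm.aemeasurable (ae_of_all _ hIcc)
    have hmgf : ∫ x, Real.exp (t * (ψ x - m)) ∂μ ≤ Real.exp (c ^ 2 * t ^ 2 / 8) := by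
      have := hH.mgf_le t
      rw [mgf] at this
      refine this.trans (Real.exp_le_exp.2 (le_of_eq ?_))
      simp [div_pow]
      ring
    calc _ ≤ ∫ x, Real.exp (t * (ψ x - m)) * Real.exp (n * (c ^ 2 * t ^ 2 / 8)) ∂μ := by
          refine integral_mono ?_ ((hH.integrable_exp_mul t).mul_const _) hinner
          refine integrable_of_abs_le (M := Real.exp (|t| * (2 * M))) ?_ fun x => ?_
          · exact ((hexpm.comp measurable_fin_cons).stronglyMeasurable.integral_prod_right'
              (ν := ν)).measurable
          · have := norm_integral_le_of_norm_le_const (μ := ν)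
              (f := fun s => Real.exp (t * (φ (Fin.cons x s) - m))) (C := Real.exp (|t| * (2 * M)))
              (ae_of_all _ fun s => hexpM _)
            simpa using this
      _ = (∫ x, Real.exp (t * (ψ x - m)) ∂μ) * Real.exp (n * (c ^ 2 * t ^ 2 / 8)) :=
          integral_mul_const _ _
      _ ≤ Real.exp (c ^ 2 * t ^ 2 / 8) * Real.exp (n * (c ^ 2 * t ^ 2 / 8)) :=
          mul_le_mul_of_nonneg_right hmgf (Real.exp_pos _).le
      _ = _ := by
          rw [← Real.exp_add]
          push_cast
          ring_nf

/-- The bounded differences (McDiarmid) inequality, for differences `1 / n`. -/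
theorem measure_ge_le_of_bounded_differences (μ : Measure X) [IsProbabilityMeasure μ]
    {n : ℕ} (hn : 0 < n) (φ : (Fin n → X) → ℝ) (hφ : Measurable φ) {M : ℝ} (hM : ∀ s, |φ s| ≤ M)
    (hc : ∀ s i x, φ s - φ (Function.update s i x) ≤ 1 / n) {δ : ℝ} (hδ : 0 < δ) (hδ1 : δ ≤ 1) :
    (Measure.pi fun _ : Fin n => μ)
      {s | ∫ s', φ s' ∂(Measure.pi fun _ => μ) + √(Real.log (1 / δ) / (2 * n)) ≤ φ s} ≤
      ENNReal.ofReal δ := by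
  set ν : Measure (Fin n → X) := Measure.pi fun _ => μ
  set m := ∫ s', φ s' ∂ν
  set u := √(Real.log (1 / δ) / (2 * n)) with hu
  have hn' : (0 : ℝ) < n := by exact_mod_cast hn
  have hlog : 0 ≤ Real.log (1 / δ) := Real.log_nonneg (by rw [le_div_iff₀ hδ]; linarith)
  have hu2 : u ^ 2 = Real.log (1 / δ) / (2 * n) := Real.sq_sqrt (by positivity)
  set t : ℝ := 4 * n * u with ht
  have ht0 : 0 ≤ t := by positivity
  have hint : Integrable (fun s => Real.exp (t * (φ s - m))) ν := by
    refine integrable_of_abs_le (M := Real.exp (t * (M - m))) (by fun_prop) fun s => ?_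
    rw [Real.abs_exp]
    exact Real.exp_le_exp.2 (mul_le_mul_of_nonneg_left
      (sub_le_sub_right (abs_le.1 (hM s)).2 _) ht0)
  have hmarkov := mul_meas_ge_le_integral_of_nonneg (μ := ν)
    (ae_of_all _ fun s => (Real.exp_pos (t * (φ s - m))).le) hint (Real.exp (t * u))
  have hmgf := integral_exp_le_of_bounded_differences μ t n φ hφ hM hc
  have hsub : {s | m + u ≤ φ s} ⊆ {s | Real.exp (t * u) ≤ Real.exp (t * (φ s - m))} := by
    intro s hs
    exact Real.exp_le_exp.2 (mul_le_mul_of_nonneg_left (by simp at hs; linarith) ht0)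
  have hreal : ν.real {s | m + u ≤ φ s} ≤ δ := by
    refine (measureReal_mono hsub).trans ?_
    have h1 := hmarkov.trans hmgf
    rw [mul_comm, ← le_div_iff₀ (Real.exp_pos _), ← Real.exp_sub] at h1
    refine h1.trans (le_of_eq ?_)
    have : (n : ℝ) * ((1 / n) ^ 2 * t ^ 2 / 8) - t * u = - Real.log (1 / δ) := by
      rw [ht]
      field_simp
      have := hu2
      field_simp at this
      nlinarith
    rw [this, Real.exp_neg, Real.exp_log (by positivity)]
    simp
  rw [← ofReal_measureReal]
  exact ENNReal.ofReal_le_ofReal hreal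

end Concentration

section Symmetrization

/-- The sign `±1` of a Boolean. -/
def boolSign (c : Bool) : ℝ := if c then 1 else -1

theorem abs_boolSign (c : Bool) : |boolSign c| = 1 := by
  cases c <;> simp [boolSign]

theorem boolSign_not (c : Bool) : boolSign (!c) = -boolSign c := by
  cases c <;> simp [boolSign]

/-- `n` times the Rademacher complexity of a finite family of vectors: the mean over all signs `σ`
of the maximum of `⟨σ, v i⟩`. -/
noncomputable def rademacherMean {ι : Type*} {n : ℕ} (v : ι → Fin n → ℝ) : ℝ :=
  (2 ^ n)⁻¹ * ∑ σ : Fin n → Bool, ⨆ i, ∑ k, boolSign (σ k) * v i k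

variable {X : Type*} [MeasurableSpace X]

theorem abs_integral_sub_mean_le_one (μ : Measure X) [IsProbabilityMeasure μ] {n : ℕ}
    (hn : 0 < n) {f : X → ℝ} (hf : Measurable f) (h0 : ∀ x, 0 ≤ f x) (h1 : ∀ x, f x ≤ 1)
    (s : Fin n → X) : |∫ x, f x ∂μ - (∑ k, f (s k)) / n| ≤ 1 := by
  have hn' : (0 : ℝ) < n := by exact_mod_cast hn
  have hfi : Integrable f μ := integrable_of_abs_le (M := 1) hf fun x =>
    abs_le.2 ⟨by linarith [h0 x], h1 x⟩
  have e1 : 0 ≤ ∫ x, f x ∂μ := integral_nonneg h0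
  have e2 : ∫ x, f x ∂μ ≤ 1 := by
    simpa using integral_mono hfi (integrable_const (1 : ℝ)) h1
  have e3 : 0 ≤ (∑ k, f (s k)) / n :=
    div_nonneg (Finset.sum_nonneg fun k _ => h0 _) hn'.le
  have e4 : (∑ k, f (s k)) / n ≤ 1 := by
    rw [div_le_one hn']
    simpa using Finset.sum_le_sum fun k (_ : k ∈ Finset.univ) => h1 (s k)
  exact abs_le.2 ⟨by linarith, by linarith⟩

theorem le_iSup_of_finite {ι : Type*} [Finite ι] (f : ι → ℝ) (i : ι) : f i ≤ ⨆ i, f i :=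
  le_ciSup (Set.finite_range f).bddAbove i

theorem inv_two_pow_mul_sum_iSup_neg {ι : Type*} {n : ℕ} (v : ι → Fin n → ℝ) :
    (2 ^ n)⁻¹ * ∑ σ : Fin n → Bool, ⨆ i, ∑ k, -(boolSign (σ k) * v i k) = rademacherMean v := by
  rw [rademacherMean]
  congr 1
  refine Fintype.sum_equiv (Equiv.piCongrRight fun _ => Equiv.boolNot) _ _ fun σ => ?_
  simp [boolSign_not]

variable {ι : Type*} [Finite ι] [Nonempty ι]

theorem abs_iSup_le_of_finite {f : ι → ℝ} {M : ℝ} (h : ∀ i, |f i| ≤ M) : |⨆ i, f i| ≤ M := by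
  obtain ⟨i⟩ := ‹Nonempty ι›
  have : Nonempty ι := ⟨i⟩
  exact abs_le.2 ⟨(abs_le.1 (h i)).1.trans (le_iSup_of_finite f i),
    ciSup_le fun i => (abs_le.1 (h i)).2⟩

theorem iSup_add_le_of_finite (f g : ι → ℝ) : ⨆ i, (f i + g i) ≤ (⨆ i, f i) + ⨆ i, g i :=
  ciSup_le fun i => add_le_add (le_iSup_of_finite f i) (le_iSup_of_finite g i)

/-- Symmetrization: the expected one-sided uniform deviation of the empirical means of a finite
family is at most twice its Rademacher complexity. -/
theorem integral_iSup_deviation_le (μ : Measure X) [IsProbabilityMeasure μ] {n : ℕ} (hn : 0 < n)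
    (f : ι → X → ℝ) (hf : ∀ i, Measurable (f i)) (h0 : ∀ i x, 0 ≤ f i x) (h1 : ∀ i x, f i x ≤ 1)
    {B : ℝ} (hB : ∀ s : Fin n → X, rademacherMean (fun i k => f i (s k)) ≤ n * B) :
    ∫ s : Fin n → X, ⨆ i, (∫ x, f i x ∂μ - (∑ k, f i (s k)) / n) ∂(Measure.pi fun _ => μ) ≤
      2 * B := by
  have hn' : (0 : ℝ) < n := by exact_mod_cast hn
  set ν : Measure (Fin n → X) := Measure.pi fun _ => μ
  set ψ : (Fin n → Bool) → (Fin n → X) × (Fin n → X) → ℝ := fun σ p =>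
    ⨆ i, ∑ k, boolSign (σ k) * (f i (p.2 k) - f i (p.1 k)) with hψ
  have hψm : ∀ σ, Measurable (ψ σ) := fun σ =>
    Measurable.iSup fun i => Finset.measurable_sum _ fun k _ => by fun_prop
  have hψM : ∀ σ p, |ψ σ p| ≤ n := fun σ p => by
    refine abs_iSup_le_of_finite fun i => ?_
    calc _ ≤ ∑ k : Fin n, |boolSign (σ k) * (f i (p.2 k) - f i (p.1 k))| :=
          Finset.abs_sum_le_sum_abs _ _
      _ ≤ ∑ k : Fin n, (1 : ℝ) := by
          refine Finset.sum_le_sum fun k _ => ?_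
          rw [abs_mul, abs_boolSign, one_mul, abs_le]
          constructor <;> linarith [h0 i (p.1 k), h0 i (p.2 k), h1 i (p.1 k), h1 i (p.2 k)]
      _ = n := by simp
  have hψi : ∀ σ, Integrable (ψ σ) (ν.prod ν) := fun σ => integrable_of_abs_le (hψm σ) (hψM σ)
  have hfe : ∀ i k, Integrable (fun s : Fin n → X => f i (s k)) ν := fun i k =>
    integrable_of_abs_le (M := 1) (by fun_prop) fun s =>
      abs_le.2 ⟨by linarith [h0 i (s k)], h1 i (s k)⟩
  have hev : ∀ i k, ∫ s : Fin n → X, f i (s k) ∂ν = ∫ x, f i x ∂μ := fun i k =>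
    integral_comp_eval (μ := fun _ : Fin n => μ) (hf i).aestronglyMeasurable
  -- the expectation of `f i` is the mean over an independent copy of the sample
  have hghost : ∀ s, ⨆ i, (∫ x, f i x ∂μ - (∑ k, f i (s k)) / n) ≤
      (∫ s', ψ (fun _ => true) (s, s') ∂ν) / n := fun s => by
    refine ciSup_le fun i => ?_
    have : ∫ x, f i x ∂μ - (∑ k, f i (s k)) / n =
        (∫ s', ∑ k, (f i (s' k) - f i (s k)) ∂ν) / n := by
      rw [integral_finsetSum (f := fun k (s' : Fin n → X) => f i (s' k) - f i (s k)) _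
        fun k _ => (hfe i k).sub (integrable_const _)]
      have : ∀ k, ∫ s', (f i (s' k) - f i (s k)) ∂ν = ∫ x, f i x ∂μ - f i (s k) := fun k => by
        rw [integral_sub (hfe i k) (integrable_const _), hev]
        simp
      simp only [this, Finset.sum_sub_distrib]
      simp
      field_simp
    rw [this]
    refine div_le_div_of_nonneg_right ?_ hn'.le
    refine integral_mono (integrable_finsetSum _ fun k _ => (hfe i k).sub (integrable_const _))
      (integrable_of_abs_le ((hψm _).comp measurable_prodMk_left) fun s' => hψM _ _) fun s' => ?_
    refine le_trans (le_of_eq ?_)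
      (le_iSup_of_finite (fun i => ∑ k, boolSign true * (f i (s' k) - f i (s k))) i)
    simp [boolSign]
  -- swapping the two copies at the indices where `σ` is `false` preserves the measure
  have hswap : ∀ σ, ∫ p, ψ σ p ∂(ν.prod ν) = ∫ p, ψ (fun _ => true) p ∂(ν.prod ν) := fun σ => by
    have he := measurePreserving_arrowProdEquivProdArrow X X (Fin n) (fun _ => μ) fun _ => μ
    have hT : MeasurePreserving
        (fun (w : Fin n → X × X) k => (if σ k then id else Prod.swap) (w k))
        (Measure.pi fun _ => μ.prod μ) (Measure.pi fun _ => μ.prod μ) := by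
      refine measurePreserving_pi _ _ fun k => ?_
      split_ifs
      · exact MeasurePreserving.id _
      · exact Measure.measurePreserving_swap
    rw [← he.integral_comp', ← he.integral_comp']
    nth_rw 2 [← hT.map_eq]
    have hm : Measurable fun w =>
        ψ (fun _ => true) (MeasurableEquiv.arrowProdEquivProdArrow X X (Fin n) w) :=
      (hψm _).comp (MeasurableEquiv.measurable _)
    rw [integral_map hT.aemeasurable hm.aestronglyMeasurable]
    refine integral_congr_ae (ae_of_all _ fun w => ?_)
    simp only [hψ]
    congr 1
    ext i
    refine Finset.sum_congr rfl fun k _ => ?_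
    cases h : σ k <;>
      simp [MeasurableEquiv.arrowProdEquivProdArrow, Equiv.arrowProdEquivProdArrow, boolSign, h]
  have hmean : ∀ p, (2 ^ n)⁻¹ * ∑ σ, ψ σ p ≤ 2 * (n * B) := fun p => by
    have : ∀ σ, ψ σ p ≤ (⨆ i, ∑ k, boolSign (σ k) * f i (p.2 k)) +
        ⨆ i, ∑ k, -(boolSign (σ k) * f i (p.1 k)) := fun σ => by
      refine le_trans (le_of_eq ?_) (iSup_add_le_of_finite _ _)
      simp only [hψ]
      congr 1
      ext i
      rw [← Finset.sum_add_distrib]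
      exact Finset.sum_congr rfl fun k _ => by ring
    calc _ ≤ (2 ^ n)⁻¹ * ∑ σ : Fin n → Bool, ((⨆ i, ∑ k, boolSign (σ k) * f i (p.2 k)) +
        ⨆ i, ∑ k, -(boolSign (σ k) * f i (p.1 k))) :=
          mul_le_mul_of_nonneg_left (Finset.sum_le_sum fun σ _ => this σ) (by positivity)
      _ = rademacherMean (fun i k => f i (p.2 k)) + rademacherMean (fun i k => f i (p.1 k)) := by
          rw [Finset.sum_add_distrib, mul_add, inv_two_pow_mul_sum_iSup_neg]
          rfl
      _ ≤ _ := by linarith [hB p.1, hB p.2]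
  have hψ2 : ∫ p, ψ (fun _ => true) p ∂(ν.prod ν) ≤ 2 * (n * B) := by
    calc _ = (2 ^ n)⁻¹ * ∑ σ, ∫ p, ψ σ p ∂(ν.prod ν) := by
          simp [hswap]
      _ = ∫ p, (2 ^ n)⁻¹ * ∑ σ, ψ σ p ∂(ν.prod ν) := by
          rw [integral_const_mul, integral_finsetSum _ fun σ _ => hψi σ]
      _ ≤ ∫ _, 2 * (n * B) ∂(ν.prod ν) :=
          integral_mono ((integrable_finsetSum _ fun σ _ => hψi σ).const_mul _)
            (integrable_const _) hmean
      _ = _ := by simp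
  calc _ ≤ ∫ s, (∫ s', ψ (fun _ => true) (s, s') ∂ν) / n ∂ν := by
        refine integral_mono ?_ ((hψi _).integral_prod_left.div_const _) hghost
        refine integrable_of_abs_le (M := 1) ?_ fun s => ?_
        · exact Measurable.iSup fun i => by fun_prop
        · exact abs_iSup_le_of_finite fun i =>
            abs_integral_sub_mean_le_one μ hn (hf i) (h0 i) (h1 i) s
    _ = (∫ p, ψ (fun _ => true) p ∂(ν.prod ν)) / n := by
        rw [integral_div, integral_prod _ (hψi _)]
    _ ≤ 2 * B := by
        rw [div_le_iff₀ hn']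
        linarith

/-- A uniform one-sided deviation bound for a finite family of functions with values in `[0, 1]`
whose Rademacher complexity is at most `B` on every sample. -/
theorem measure_exists_deviation_le (μ : Measure X) [IsProbabilityMeasure μ] {n : ℕ} (hn : 0 < n)
    (f : ι → X → ℝ) (hf : ∀ i, Measurable (f i)) (h0 : ∀ i x, 0 ≤ f i x) (h1 : ∀ i x, f i x ≤ 1)
    {B : ℝ} (hB : ∀ s : Fin n → X, rademacherMean (fun i k => f i (s k)) ≤ n * B)
    {δ : ℝ} (hδ : 0 < δ) (hδ1 : δ ≤ 1) :
    (Measure.pi fun _ : Fin n => μ)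
      {s | ∃ i, (∑ k, f i (s k)) / n + 2 * B + √(Real.log (1 / δ) / (2 * n)) < ∫ x, f i x ∂μ} ≤
      ENNReal.ofReal δ := by
  have hn' : (0 : ℝ) < n := by exact_mod_cast hn
  set φ : (Fin n → X) → ℝ := fun s => ⨆ i, (∫ x, f i x ∂μ - (∑ k, f i (s k)) / n) with hφ
  have hM : ∀ s, |φ s| ≤ 1 := fun s => abs_iSup_le_of_finite fun i =>
    abs_integral_sub_mean_le_one μ hn (hf i) (h0 i) (h1 i) s
  have hc : ∀ s i x, φ s - φ (Function.update s i x) ≤ 1 / n := fun s k x => by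
    rw [sub_le_iff_le_add]
    refine ciSup_le fun i => ?_
    have h := le_iSup_of_finite
      (fun i => ∫ x, f i x ∂μ - (∑ j, f i (Function.update s k x j)) / n) i
    have hs : ∑ j, f i (Function.update s k x j) - ∑ j, f i (s j) ≤ 1 := by
      rw [← Finset.sum_sub_distrib, Finset.sum_eq_single k]
      · simp only [Function.update_self]
        linarith [h0 i (s k), h1 i x]
      · intro j _ hj
        simp [Function.update_of_ne hj]
      · simp
    have hs' : (∑ j, f i (Function.update s k x j)) / n - (∑ j, f i (s j)) / n ≤ 1 / n := by
      rw [← sub_div]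
      exact div_le_div_of_nonneg_right hs hn'.le
    simp only [hφ] at h ⊢
    linarith
  refine (measure_mono fun s hs => ?_).trans (measure_ge_le_of_bounded_differences μ hn φ
    (Measurable.iSup fun i => by fun_prop) hM hc hδ hδ1)
  obtain ⟨i, hi⟩ := hs
  have h := le_iSup_of_finite (fun i => ∫ x, f i x ∂μ - (∑ k, f i (s k)) / n) i
  have hE := integral_iSup_deviation_le μ hn f hf h0 h1 hB
  simp only [Set.mem_ofPred_eq, hφ] at h ⊢
  linarith

end Symmetrization

section Chaining

theorem sum_exp_boolSign {n : ℕ} (t : Fin n → ℝ) :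
    ∑ σ : Fin n → Bool, Real.exp (∑ k, boolSign (σ k) * t k) = 2 ^ n * ∏ k, Real.cosh (t k) := by
  have h : ∀ k, ∑ c : Bool, Real.exp (boolSign c * t k) = 2 * Real.cosh (t k) := fun k => by
    simp [boolSign, Real.cosh_eq]
    ring
  simp_rw [Real.exp_sum]
  rw [← Fintype.prod_sum fun k c => Real.exp (boolSign c * t k)]
  simp_rw [h, Finset.prod_mul_distrib]
  simp

/-- Massart's finite class lemma, with a free parameter. -/
theorem mul_rademacherMean_le {ι : Type*} [Finite ι] [Nonempty ι] {n : ℕ} (v : ι → Fin n → ℝ)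
    (T : Finset (Fin n → ℝ)) (hT : ∀ i, v i ∈ T) {r : ℝ} (hr : ∀ i k, |v i k| ≤ r) {K : ℝ}
    (hK : Real.log T.card ≤ K) {x : ℝ} (hx : 0 ≤ x) :
    x * rademacherMean v ≤ K + n * (x * r) ^ 2 / 2 := by
  classical
  have := Fintype.ofFinite ι
  set T' : Finset (Fin n → ℝ) := Finset.univ.image v with hT'
  have hTT : T' ⊆ T := fun t ht => by
    obtain ⟨i, -, rfl⟩ := Finset.mem_image.1 ht
    exact hT i
  have hT'pos : 0 < T'.card := Finset.card_pos.2 (Finset.univ_nonempty.image v)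
  have hcard : (0 : ℝ) < T'.card := by exact_mod_cast hT'pos
  have hmean : Real.exp (x * rademacherMean v) ≤
      T'.card * Real.exp (n * (x * r) ^ 2 / 2) := by
    calc Real.exp (x * rademacherMean v)
        = Real.exp (∑ σ : Fin n → Bool, (2 ^ n : ℝ)⁻¹ •
            (x * ⨆ i, ∑ k, boolSign (σ k) * v i k)) := by
          rw [rademacherMean, ← Finset.smul_sum, ← Finset.mul_sum, smul_eq_mul]
          ring_nf
      _ ≤ ∑ σ : Fin n → Bool, (2 ^ n : ℝ)⁻¹ •
            Real.exp (x * ⨆ i, ∑ k, boolSign (σ k) * v i k) := by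
          refine convexOn_exp.map_sum_le (fun _ _ => by positivity) ?_ fun _ _ => Set.mem_univ _
          simp
      _ ≤ ∑ σ : Fin n → Bool, (2 ^ n : ℝ)⁻¹ •
            ∑ t ∈ T', Real.exp (∑ k, boolSign (σ k) * (x * t k)) := by
          refine Finset.sum_le_sum fun σ _ => ?_
          refine mul_le_mul_of_nonneg_left ?_ (by positivity)
          obtain ⟨i, hi⟩ := exists_eq_ciSup_of_finite (f := fun i => ∑ k, boolSign (σ k) * v i k)
          rw [← hi]
          refine le_trans (le_of_eq ?_) (Finset.single_le_sum
            (f := fun t : Fin n → ℝ => Real.exp (∑ k, boolSign (σ k) * (x * t k)))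
            (fun _ _ => (Real.exp_pos _).le) (Finset.mem_image_of_mem v (Finset.mem_univ i)))
          simp only [Finset.mul_sum]
          congr 1
          exact Finset.sum_congr rfl fun k _ => by ring
      _ = ∑ t ∈ T', ∏ k, Real.cosh (x * t k) := by
          rw [← Finset.smul_sum, Finset.sum_comm]
          simp_rw [sum_exp_boolSign]
          rw [← Finset.mul_sum, smul_eq_mul, inv_mul_cancel_left₀ (by positivity)]
      _ ≤ ∑ t ∈ T', Real.exp (n * (x * r) ^ 2 / 2) := by
          refine Finset.sum_le_sum fun t ht => ?_
          obtain ⟨i, -, rfl⟩ := Finset.mem_image.1 ht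
          calc _ ≤ ∏ k : Fin n, Real.exp ((x * r) ^ 2 / 2) := by
                refine Finset.prod_le_prod (fun _ _ => (Real.cosh_pos _).le) fun k _ => ?_
                refine (Real.cosh_le_exp_half_sq _).trans (Real.exp_le_exp.2 ?_)
                refine div_le_div_of_nonneg_right ?_ (by norm_num)
                rw [← sq_abs (x * v i k), abs_mul, abs_of_nonneg hx]
                gcongr
                exact hr i k
            _ = _ := by
                rw [Finset.prod_const, ← Real.exp_nat_mul]
                simp
                ring
      _ = _ := by simp
  have h2 := Real.log_le_log (Real.exp_pos _) hmean
  rw [Real.log_exp, Real.log_mul hcard.ne' (Real.exp_pos _).ne', Real.log_exp] at h2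
  have h3 : Real.log T'.card ≤ Real.log T.card :=
    Real.log_le_log hcard (by exact_mod_cast Finset.card_le_card hTT)
  linarith

/-- Massart's finite class lemma. -/
theorem rademacherMean_le {ι : Type*} [Finite ι] [Nonempty ι] {n : ℕ} (v : ι → Fin n → ℝ)
    (T : Finset (Fin n → ℝ)) (hT : ∀ i, v i ∈ T) {r : ℝ} (hr : ∀ i k, |v i k| ≤ r) (hr0 : 0 < r)
    (hn : 0 < n) {K : ℝ} (hK : Real.log T.card ≤ K) (hK0 : 0 ≤ K) :
    rademacherMean v ≤ r * √(2 * n * K) := by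
  have hn' : (0 : ℝ) < n := by exact_mod_cast hn
  refine le_of_forall_pos_le_add fun e he => ?_
  set q := √(2 * n * K) + e / r with hq
  have hs0 : 0 ≤ √(2 * n * K) := Real.sqrt_nonneg _
  have her : 0 < e / r := by positivity
  have hq0 : 0 < q := by positivity
  have hq2 : 2 * n * K ≤ q ^ 2 := by
    nlinarith [Real.sq_sqrt (show 0 ≤ 2 * n * K by positivity), mul_nonneg hs0 her.le, sq_nonneg (e / r)]
  have h := mul_rademacherMean_le v T hT hr hK (x := q / (n * r)) (by positivity)
  have h2 : q / (n * r) * rademacherMean v ≤ q / (n * r) * (r * q) := by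
    refine h.trans ?_
    have e1 : q / (n * r) * (r * q) = q ^ 2 / n := by field_simp
    have e2 : n * (q / (n * r) * r) ^ 2 / 2 = q ^ 2 / n / 2 := by field_simp
    have e3 : K ≤ q ^ 2 / n / 2 := by
      rw [div_div, le_div_iff₀ (by positivity)]
      linarith
    rw [e1, e2]
    linarith
  have h3 := le_of_mul_le_mul_left h2 (by positivity)
  refine h3.trans (le_of_eq ?_)
  rw [hq]
  field_simp

theorem rademacherMean_add_le {ι : Type*} [Finite ι] [Nonempty ι] {n : ℕ}
    (v w : ι → Fin n → ℝ) :
    rademacherMean (fun i k => v i k + w i k) ≤ rademacherMean v + rademacherMean w := by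
  rw [rademacherMean, rademacherMean, rademacherMean, ← mul_add, ← Finset.sum_add_distrib]
  refine mul_le_mul_of_nonneg_left (Finset.sum_le_sum fun σ _ => ?_) (by positivity)
  simp only [mul_add, Finset.sum_add_distrib]
  exact iSup_add_le_of_finite _ _

theorem rademacherMean_le_of_abs_le {ι : Type*} [Finite ι] [Nonempty ι] {n : ℕ}
    (v : ι → Fin n → ℝ) {r : ℝ} (hr : ∀ i k, |v i k| ≤ r) : rademacherMean v ≤ n * r := by
  calc rademacherMean v ≤ (2 ^ n)⁻¹ * ∑ σ : Fin n → Bool, n * r := by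
        refine mul_le_mul_of_nonneg_left (Finset.sum_le_sum fun σ _ => ?_) (by positivity)
        refine ciSup_le fun i => ?_
        calc _ ≤ ∑ k : Fin n, r := Finset.sum_le_sum fun k _ => (le_abs_self _).trans (by
              rw [abs_mul, abs_boolSign, one_mul]
              exact hr i k)
          _ = n * r := by simp
    _ = n * r := by simp

/-- Chaining over the scales `2⁻ʲ`, for sup-norm covers of log-cardinality `H * 4 ^ j`. -/
theorem rademacherMean_le_of_covers {ι : Type*} [Finite ι] [Nonempty ι] {n : ℕ} (hn : 0 < n)
    (v : ι → Fin n → ℝ) (h0 : ∀ i k, 0 ≤ v i k) (h1 : ∀ i k, v i k ≤ 1) {H : ℝ} (hH : 0 ≤ H)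
    (hcov : ∀ j : ℕ, ∃ C : Finset (Fin n → ℝ), Real.log C.card ≤ H * 4 ^ j ∧
      ∀ i, ∃ t ∈ C, ∀ k, |v i k - t k| ≤ (2 ^ j : ℝ)⁻¹) (J : ℕ) :
    rademacherMean v ≤ n * ((2 ^ J)⁻¹ + J * (6 * √(H / n))) := by
  classical
  have hn' : (0 : ℝ) < n := by exact_mod_cast hn
  choose C hC hCv using hcov
  choose π hπ hπv using hCv
  set p : ℕ → ι → Fin n → ℝ := fun j => if j = 0 then fun _ _ => 0 else π j with hp
  have hp0 : p 0 = fun _ _ => 0 := by simp [hp]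
  set D : ℕ → Finset (Fin n → ℝ) := fun j => if j = 0 then {fun _ => 0} else C j with hD
  have hpD : ∀ j i, p j i ∈ D j := fun j i => by
    cases j with
    | zero => simp [hp, hD]
    | succ j => simpa [hp, hD] using hπ (j + 1) i
  have hDc : ∀ j, Real.log (D j).card ≤ H * 4 ^ j := fun j => by
    cases j with
    | zero => simpa [hD] using hH
    | succ j => simpa [hD] using hC (j + 1)
  have hpv : ∀ j i k, |v i k - p j i k| ≤ (2 ^ j : ℝ)⁻¹ := fun j i k => by
    cases j with
    | zero => simpa [hp, abs_of_nonneg (h0 i k)] using h1 i k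
    | succ j => simpa [hp] using hπv (j + 1) i k
  have hlink : ∀ j, rademacherMean (fun i k => p (j + 1) i k - p j i k) ≤ n * (6 * √(H / n)) :=
    fun j => by
    obtain ⟨i₀⟩ := ‹Nonempty ι›
    have : Nonempty ι := ⟨i₀⟩
    have hpos : ∀ j, (0 : ℝ) < (D j).card := fun j => by
      exact_mod_cast Finset.card_pos.2 ⟨_, hpD j i₀⟩
    set T := (D (j + 1) ×ˢ D j).image fun q k => q.1 k - q.2 k with hTdef
    have hTpos : (0 : ℝ) < T.card := by
      refine Nat.cast_pos.2 (Finset.card_pos.2 (Finset.Nonempty.image ?_ _))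
      exact ⟨(_, _), Finset.mem_product.2 ⟨hpD (j + 1) i₀, hpD j i₀⟩⟩
    have hT : Real.log T.card ≤ 2 * (H * 4 ^ (j + 1)) := by
      have : (T.card : ℝ) ≤ (D (j + 1)).card * (D j).card := by
        exact_mod_cast Finset.card_image_le.trans (Finset.card_product _ _).le
      have h2 := Real.log_le_log hTpos this
      rw [Real.log_mul (hpos _).ne' (hpos _).ne'] at h2
      have h3 : H * 4 ^ j ≤ H * 4 ^ (j + 1) :=
        mul_le_mul_of_nonneg_left (pow_le_pow_right₀ (by norm_num) (Nat.le_succ j)) hH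
      linarith [hDc j, hDc (j + 1)]
    have := rademacherMean_le (fun i k => p (j + 1) i k - p j i k) T
      (fun i => Finset.mem_image.2 ⟨(p (j + 1) i, p j i),
        Finset.mem_product.2 ⟨hpD _ i, hpD _ i⟩, rfl⟩) (r := 3 * (2 ^ (j + 1) : ℝ)⁻¹)
      (fun i k => ?_) (by positivity) hn hT (by positivity)
    · refine this.trans (le_of_eq ?_)
      have e1 : (2 : ℝ) * n * (2 * (H * 4 ^ (j + 1))) = (2 * n * 2 ^ (j + 1)) ^ 2 * (H / n) := by
        rw [show (4 : ℝ) = 2 ^ 2 by norm_num, ← pow_mul]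
        field_simp
        ring
      rw [e1, Real.sqrt_mul (by positivity), Real.sqrt_sq (by positivity)]
      field_simp
      ring
    · have a1 := hpv (j + 1) i k
      have a2 := hpv j i k
      have a3 : (2 ^ j : ℝ)⁻¹ = 2 * (2 ^ (j + 1) : ℝ)⁻¹ := by
        rw [pow_succ]
        field_simp
      rw [abs_le] at *
      constructor <;> linarith
  have hpJ : ∀ J : ℕ, rademacherMean (p J) ≤ n * (J * (6 * √(H / n))) := fun J => by
    induction J with
    | zero =>
      refine (rademacherMean_le_of_abs_le (p 0) (r := 0) (by simp [hp0])).trans ?_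
      simp
    | succ J ih =>
      have := rademacherMean_add_le (p J) fun i k => p (J + 1) i k - p J i k
      simp only [add_sub_cancel] at this
      have h2 := hlink J
      refine this.trans ((add_le_add ih h2).trans (le_of_eq ?_))
      push_cast
      ring
  have h := rademacherMean_add_le (p J) fun i k => v i k - p J i k
  simp only [add_sub_cancel] at h
  have h2 := rademacherMean_le_of_abs_le (fun i k => v i k - p J i k) (hpv J)
  have h3 := hpJ J
  rw [mul_add]
  linarith

end Chaining

section LinearCover

theorem exists_finset_forall_sum_le_mem (X : Type*) [Fintype X] (T : ℕ) :
    ∃ S : Finset (X → ℕ), S.card ≤ (Fintype.card X + 1) ^ T ∧ ∀ g : X → ℕ, ∑ x, g x ≤ T → g ∈ S := by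
  classical
  induction T with
  | zero =>
    refine ⟨{0}, by simp, fun g hg => ?_⟩
    rw [Finset.mem_singleton]
    ext x
    simpa using (Finset.sum_eq_zero_iff.1 (Nat.le_zero.1 hg)) x (Finset.mem_univ x)
  | succ T ih =>
    obtain ⟨S, hS, hgS⟩ := ih
    refine ⟨S ∪ (Finset.univ ×ˢ S).image fun q : X × (X → ℕ) => q.2 + Pi.single q.1 1, ?_,
      fun g hg => ?_⟩
    · calc _ ≤ S.card + Fintype.card X * S.card := by
            refine (Finset.card_union_le _ _).trans (Nat.add_le_add_left ?_ _)
            refine Finset.card_image_le.trans ?_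
            rw [Finset.card_product, Finset.card_univ]
        _ = S.card * (Fintype.card X + 1) := by ring
        _ ≤ _ := by
            rw [pow_succ]
            exact Nat.mul_le_mul_right _ hS
    · rw [Finset.mem_union]
      by_cases h : ∀ x, g x = 0
      · exact Or.inl (hgS g (by simp [h]))
      · push Not at h
        obtain ⟨x, hx⟩ := h
        have hge : Pi.single x 1 ≤ g := by
          intro y
          by_cases hy : y = x
          · subst hy
            simpa using Nat.one_le_iff_ne_zero.2 hx
          · simp [hy]
        refine Or.inr (Finset.mem_image.2 ⟨(x, g - Pi.single x 1),
          Finset.mem_product.2 ⟨Finset.mem_univ _, hgS _ ?_⟩, ?_⟩)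
        · have h1 : ∑ y, (g - Pi.single x 1 : X → ℕ) y + ∑ y, (Pi.single x 1 : X → ℕ) y =
              ∑ y, g y := by
            rw [← Finset.sum_add_distrib]
            exact Finset.sum_congr rfl fun y _ => Nat.sub_add_cancel (hge y)
          simp only [Finset.sum_pi_single', Finset.mem_univ, if_true] at h1
          simp only
          omega
        · exact tsub_add_cancel_of_le hge

variable {E : Type*} [NormedAddCommGroup E] [InnerProductSpace ℝ E]

open scoped RealInnerProductSpace

/-- A signed combination of the points `p q` with integer coefficients. -/
noncomputable def signedSum {Q : Type*} [Fintype Q] (p : Q → E) (g : Q × SignType → ℕ) : E :=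
  ∑ x, ((g x : ℝ) * (x.2 : ℝ)) • p x.1

theorem signedSum_add_single {Q : Type*} [Fintype Q] [DecidableEq Q] (p : Q → E)
    (g : Q × SignType → ℕ) (x : Q × SignType) :
    signedSum p (g + Pi.single x 1) = signedSum p g + (x.2 : ℝ) • p x.1 := by
  have h : ∀ y : Q × SignType, (((g + Pi.single x 1 : Q × SignType → ℕ) y : ℝ) * (y.2 : ℝ)) • p y.1
      = ((g y : ℝ) * (y.2 : ℝ)) • p y.1 + if y = x then (x.2 : ℝ) • p x.1 else 0 := fun y => by
    by_cases hy : y = x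
    · subst hy
      simp [add_mul, add_smul]
    · simp [hy]
  simp only [signedSum, h, Finset.sum_add_distrib]
  simp

/-- The perceptron algorithm: `t` steps of size `e / b ^ 2` either approximate the functional
`⟪w, ·⟫` at all the points up to `e`, or decrease `‖w‖ ^ 2` by `t * e ^ 2 / b ^ 2`. -/
theorem exists_perceptron {Q : Type*} [Fintype Q] [Nonempty Q] (p : Q → E) {b e : ℝ} (hb : 0 < b)
    (he : 0 < e) (hp : ∀ q, ‖p q‖ ≤ b) (w : E) (t : ℕ) :
    ∃ g : Q × SignType → ℕ, ∑ x, g x = t ∧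
      ((∀ q, |⟪w - (e / b ^ 2) • signedSum p g, p q⟫| ≤ e) ∨
        ‖w - (e / b ^ 2) • signedSum p g‖ ^ 2 ≤ ‖w‖ ^ 2 - t * (e ^ 2 / b ^ 2)) := by
  classical
  induction t with
  | zero => exact ⟨0, by simp, Or.inr (by simp [signedSum])⟩
  | succ t ih =>
    obtain ⟨g, hg, h⟩ := ih
    obtain ⟨q₀⟩ := ‹Nonempty Q›
    have hsum : ∀ x, ∑ y, (g + Pi.single x 1 : Q × SignType → ℕ) y = t + 1 := fun x => by
      simp [Finset.sum_add_distrib, hg]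
    by_cases hgood : ∀ q, |⟪w - (e / b ^ 2) • signedSum p g, p q⟫| ≤ e
    · refine ⟨g + Pi.single (q₀, 0) 1, hsum _, Or.inl ?_⟩
      simpa [signedSum_add_single] using hgood
    · replace h := h.resolve_left hgood
      push Not at hgood
      obtain ⟨q, hq⟩ := hgood
      set u := w - (e / b ^ 2) • signedSum p g with hu
      set s := SignType.sign ⟪u, p q⟫ with hs
      refine ⟨g + Pi.single (q, s) 1, hsum _, Or.inr ?_⟩
      have h1 : w - (e / b ^ 2) • signedSum p (g + Pi.single (q, s) 1) =
          u - (e / b ^ 2 * (s : ℝ)) • p q := by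
        rw [signedSum_add_single, hu, smul_add, smul_smul]
        abel
      have hsabs : (s : ℝ) * ⟪u, p q⟫ = |⟪u, p q⟫| := sign_mul_self _
      have hs2 : (s : ℝ) ^ 2 ≤ 1 := by
        cases s <;> simp
      have hpq : ‖p q‖ ^ 2 ≤ b ^ 2 := pow_le_pow_left₀ (norm_nonneg _) (hp q) 2
      rw [h1, norm_sub_sq_real, inner_smul_right, norm_smul, mul_pow, Real.norm_eq_abs, sq_abs,
        mul_pow, mul_assoc, hsabs]
      have e1 : (e / b ^ 2) ^ 2 * (s : ℝ) ^ 2 * ‖p q‖ ^ 2 ≤ (e / b ^ 2) ^ 2 * 1 * b ^ 2 := by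
        gcongr
      have e2 : (e / b ^ 2) ^ 2 * 1 * b ^ 2 = e ^ 2 / b ^ 2 := by field_simp
      have e3 : e ^ 2 / b ^ 2 ≤ e / b ^ 2 * |⟪u, p q⟫| := by
        rw [sq, mul_div_right_comm]
        exact mul_le_mul_of_nonneg_left hq.le (by positivity)
      push_cast
      linarith

/-- Approximation of a vector of norm about `k * τ` by `k` steps of the perceptron algorithm. -/
theorem exists_row_approx {Q : Type*} [Fintype Q] [Nonempty Q] (p : Q → E) {b τ : ℝ} (hb : 0 < b)
    (hτ : 0 < τ) (hp : ∀ q, ‖p q‖ ≤ b) (w : E) {k : ℕ} (hk1 : k * τ ≤ ‖w‖)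
    (hk2 : ‖w‖ ≤ (k + 1) * τ) :
    ∃ g : Q × SignType → ℕ, ∑ x, g x = k ∧
      ∀ q, |⟪w - (2 * b * √k * τ / b ^ 2) • signedSum p g, p q⟫| ≤ √(4 * b ^ 2 * τ * ‖w‖) := by
  rcases Nat.eq_zero_or_pos k with rfl | hpos
  · refine ⟨0, by simp, fun q => Real.le_sqrt_of_sq_le ?_⟩
    have hc : |⟪w, p q⟫| ≤ ‖w‖ * b := (abs_real_inner_le_norm _ _).trans
      (mul_le_mul_of_nonneg_left (hp q) (norm_nonneg _))
    have h3 : ‖w‖ * ‖w‖ ≤ τ * ‖w‖ :=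
      mul_le_mul_of_nonneg_right (by simpa using hk2) (norm_nonneg _)
    have h4 : |⟪w, p q⟫| ^ 2 ≤ (‖w‖ * b) ^ 2 := pow_le_pow_left₀ (abs_nonneg _) hc 2
    have h5 := mul_le_mul_of_nonneg_right h3 (sq_nonneg b)
    have h6 : 0 ≤ b ^ 2 * τ * ‖w‖ := by positivity
    have h7 : w - (2 * b * √(0 : ℕ) * τ / b ^ 2) • signedSum p 0 = w := by simp
    rw [h7]
    nlinarith
  · have hkpos : (0 : ℝ) < k := by exact_mod_cast hpos
    have hk1' : (1 : ℝ) ≤ k := by exact_mod_cast hpos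
    set e := 2 * b * √k * τ with he
    have hepos : 0 < e := by positivity
    obtain ⟨g, hg, h⟩ := exists_perceptron p hb hepos hp w k
    have he2 : e ^ 2 = 4 * b ^ 2 * τ * (k * τ) := by
      simp only [he, mul_pow, Real.sq_sqrt hkpos.le]
      ring
    have hle : e ≤ √(4 * b ^ 2 * τ * ‖w‖) := by
      refine Real.le_sqrt_of_sq_le ?_
      rw [he2]
      exact mul_le_mul_of_nonneg_left hk1 (by positivity)
    refine ⟨g, hg, fun q => ?_⟩
    rcases h with h | h
    · exact (h q).trans hle
    · have hA2 : ‖w‖ ≤ 2 * k * τ := hk2.trans (mul_le_mul_of_nonneg_right (by linarith) hτ.le)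
      have hA3 : ‖w‖ ^ 2 ≤ (2 * k * τ) ^ 2 := pow_le_pow_left₀ (norm_nonneg _) hA2 2
      have h4 : (k : ℝ) * (e ^ 2 / b ^ 2) = (2 * k * τ) ^ 2 := by
        rw [he2]
        field_simp
        ring
      have h5 : ‖w - (e / b ^ 2) • signedSum p g‖ = 0 := by
        have : ‖w - (e / b ^ 2) • signedSum p g‖ ^ 2 ≤ 0 := by linarith
        exact pow_eq_zero_iff (two_ne_zero) |>.1 (le_antisymm this (sq_nonneg _))
      rw [norm_eq_zero] at h5
      rw [h5, inner_zero_left, abs_zero]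
      exact Real.sqrt_nonneg _

/-- A cover of the matrices with rows in `E` whose row norms sum up to at most `a`, in the
`ℓ²` norm over the rows of the sup norm over finitely many points. -/
theorem exists_matrix_cover {κ Q : Type*} [Fintype κ] [Fintype Q] (p : Q → E) {a b ε : ℝ}
    (ha : 0 < a) (hb : 0 < b) (hε : 0 < ε) (hp : ∀ q, ‖p q‖ ≤ b) :
    ∃ C : Finset (κ → E), C.Nonempty ∧
      C.card ≤ (3 * (Fintype.card κ * Fintype.card Q) + 1) ^ ⌊4 * a ^ 2 * b ^ 2 / ε ^ 2⌋₊ ∧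
      ∀ A : κ → E, ∑ j, ‖A j‖ ≤ a → ∃ A' ∈ C, ∃ e : κ → ℝ, (∀ j, 0 ≤ e j) ∧
        ∑ j, e j ^ 2 ≤ ε ^ 2 ∧ ∀ j q, |⟪A j - A' j, p q⟫| ≤ e j := by
  classical
  rcases isEmpty_or_nonempty Q with hQ | hQ
  · refine ⟨{0}, by simp, ?_, fun A _ => ⟨0, by simp, 0, by simp, by simp; positivity,
      fun j q => isEmptyElim q⟩⟩
    simp
  obtain ⟨τ, hτ⟩ : ∃ τ : ℝ, τ = ε ^ 2 / (4 * a * b ^ 2) := ⟨_, rfl⟩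
  have hτ0 : 0 < τ := hτ ▸ by positivity
  have haτ : 4 * a ^ 2 * b ^ 2 / ε ^ 2 = a / τ := by
    rw [hτ]
    field_simp
  obtain ⟨decode, hdec⟩ : ∃ decode : (κ × Q × SignType → ℕ) → κ → E, ∀ g j, decode g j =
      (2 * b * √(∑ x, g (j, x) : ℕ) * τ / b ^ 2) • signedSum p (fun x => g (j, x)) :=
    ⟨_, fun _ _ => rfl⟩
  obtain ⟨S, hS, hgS⟩ := exists_finset_forall_sum_le_mem (κ × Q × SignType)
    ⌊4 * a ^ 2 * b ^ 2 / ε ^ 2⌋₊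
  refine ⟨S.image decode, Finset.Nonempty.image ⟨0, hgS 0 (by simp)⟩ _, ?_, fun A hA => ?_⟩
  · refine Finset.card_image_le.trans (hS.trans (le_of_eq ?_))
    simp only [Fintype.card_prod, show Fintype.card SignType = 3 from rfl]
    ring
  obtain ⟨k, hk⟩ : ∃ k : κ → ℕ, ∀ j, k j = ⌊‖A j‖ / τ⌋₊ := ⟨_, fun _ => rfl⟩
  have hk1 : ∀ j, k j * τ ≤ ‖A j‖ := fun j => by
    rw [← le_div_iff₀ hτ0, hk]
    exact Nat.floor_le (by positivity)
  have hk2 : ∀ j, ‖A j‖ ≤ (k j + 1) * τ := fun j => by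
    rw [← div_le_iff₀ hτ0, hk]
    exact (Nat.lt_floor_add_one _).le
  have hrow := fun j => exists_row_approx p hb hτ0 hp (A j) (hk1 j) (hk2 j)
  choose g hg hgq using hrow
  have hgsum : ∑ x : κ × Q × SignType, g x.1 x.2 = ∑ j, k j := by
    rw [Fintype.sum_prod_type]
    exact Finset.sum_congr rfl fun j _ => hg j
  refine ⟨decode fun x => g x.1 x.2, Finset.mem_image_of_mem _ (hgS _ ?_),
    fun j => √(4 * b ^ 2 * τ * ‖A j‖), fun j => Real.sqrt_nonneg _, ?_, fun j q => ?_⟩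
  · rw [hgsum, haτ]
    refine Nat.le_floor ?_
    rw [le_div_iff₀ hτ0]
    push_cast
    rw [Finset.sum_mul]
    exact (Finset.sum_le_sum fun j _ => hk1 j).trans hA
  · have : ∀ j, √(4 * b ^ 2 * τ * ‖A j‖) ^ 2 = 4 * b ^ 2 * τ * ‖A j‖ := fun j =>
      Real.sq_sqrt (by positivity)
    simp only [this]
    rw [← Finset.mul_sum]
    calc _ ≤ 4 * b ^ 2 * τ * a := mul_le_mul_of_nonneg_left hA (by positivity)
      _ = ε ^ 2 := by
          rw [hτ]
          field_simp
  · simp only [hdec, hg]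
    exact hgq j q

end LinearCover

namespace ConvNet

open scoped RealInnerProductSpace

variable (net : ConvNet)

section Norms

/-- The `o`-th patch of `x`, as a vector of a Euclidean space. -/
def patchVec (l : ℕ) (x : net.Act l) (o : Fin (net.O l)) :
    EuclideanSpace ℝ (Fin (net.d (l + 1))) :=
  WithLp.toLp 2 fun i => x (net.patch l o i).1 (net.patch l o i).2

/-- The `j`-th filter, as a vector of a Euclidean space. -/
def filterVec (l : ℕ) (A : net.Wt l) (j : Fin (net.m (l + 1))) :
    EuclideanSpace ℝ (Fin (net.d (l + 1))) :=
  WithLp.toLp 2 (A j)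

theorem patchNorm_eq (l : ℕ) (x : net.Act l) :
    net.patchNorm l x = ⨆ o, ‖net.patchVec l x o‖ := by
  simp [patchNorm, patchVec, EuclideanSpace.norm_eq]

theorem norm21_eq (l : ℕ) (A : net.Wt l) : net.norm21 l A = ∑ j, ‖net.filterVec l A j‖ := by
  simp [norm21, filterVec, EuclideanSpace.norm_eq]

theorem conv_eq_inner (l : ℕ) (A : net.Wt l) (x : net.Act l) (j : Fin (net.m (l + 1)))
    (o : Fin (net.O l)) : net.conv l A x j o = ⟪net.filterVec l A j, net.patchVec l x o⟫ := by
  simp [conv, filterVec, patchVec, PiLp.inner_apply]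

theorem norm_patchVec_le (l : ℕ) (x : net.Act l) (o : Fin (net.O l)) :
    ‖net.patchVec l x o‖ ≤ net.patchNorm l x := by
  rw [patchNorm_eq]
  exact le_iSup_of_finite (fun o => ‖net.patchVec l x o‖) o

theorem patchNorm_nonneg (l : ℕ) (x : net.Act l) : 0 ≤ net.patchNorm l x :=
  Real.iSup_nonneg fun _ => Real.sqrt_nonneg _

theorem pixelNorm_nonneg (l : ℕ) (x : net.Act l) : 0 ≤ net.pixelNorm l x :=
  Real.iSup_nonneg fun _ => Real.sqrt_nonneg _

theorem patchNorm_add_le (l : ℕ) (x y : net.Act l) :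
    net.patchNorm l (x + y) ≤ net.patchNorm l x + net.patchNorm l y := by
  rw [patchNorm_eq]
  refine Real.iSup_le (fun o => ?_) (add_nonneg (net.patchNorm_nonneg l x)
    (net.patchNorm_nonneg l y))
  exact (norm_add_le (net.patchVec l x o) (net.patchVec l y o)).trans
    (add_le_add (net.norm_patchVec_le l x o) (net.norm_patchVec_le l y o))

theorem patchNorm_sub_comm (l : ℕ) (x y : net.Act l) :
    net.patchNorm l (x - y) = net.patchNorm l (y - x) := by
  rw [patchNorm_eq, patchNorm_eq]
  congr 1
  ext o
  exact norm_sub_rev (net.patchVec l x o) (net.patchVec l y o)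

theorem patchNorm_zero (l : ℕ) : net.patchNorm l 0 = 0 := by
  simp [patchNorm]

theorem abs_patchNorm_sub_le (l : ℕ) (x y : net.Act l) :
    |net.patchNorm l x - net.patchNorm l y| ≤ net.patchNorm l (x - y) := by
  have h1 := net.patchNorm_add_le l (x - y) y
  have h2 := net.patchNorm_add_le l (y - x) x
  rw [sub_add_cancel] at h1 h2
  rw [net.patchNorm_sub_comm l y x] at h2
  exact abs_le.2 ⟨by linarith, by linarith⟩

theorem patchNorm_sum_le (l : ℕ) {ι : Type*} (s : Finset ι) (x : ι → net.Act l) :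
    net.patchNorm l (∑ i ∈ s, x i) ≤ ∑ i ∈ s, net.patchNorm l (x i) := by
  classical
  induction s using Finset.induction_on with
  | empty => simp [patchNorm_zero]
  | insert i s hi ih =>
    rw [Finset.sum_insert hi, Finset.sum_insert hi]
    exact (net.patchNorm_add_le l _ _).trans (by linarith)

theorem abs_apply_le_patchNorm (l : ℕ) (x : net.Act l) (o : Fin (net.O l))
    (i : Fin (net.d (l + 1))) :
    |x (net.patch l o i).1 (net.patch l o i).2| ≤ net.patchNorm l x :=
  (PiLp.norm_apply_le (net.patchVec l x o) i).trans (net.norm_patchVec_le l x o)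

theorem abs_apply_le_pixelNorm (l : ℕ) (x : net.Act l) (u : Fin (net.U l)) (v : Fin (net.w l)) :
    |x u v| ≤ net.pixelNorm l x := by
  refine le_trans ?_ (le_iSup_of_finite (fun j => √(∑ u, (x u j) ^ 2)) v)
  rw [← Real.sqrt_sq_eq_abs]
  exact Real.sqrt_le_sqrt (Finset.single_le_sum (f := fun u => (x u v) ^ 2)
    (fun _ _ => sq_nonneg _) (Finset.mem_univ u))

/-- The infimum in the definition of the Lipschitz constant is attained. -/
theorem patchNorm_sub_le_of_lipConst_le {A : ∀ l, net.Wt l} {l₁ k : ℕ} {r : ℝ} (hr : 0 ≤ r)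
    (h : net.lipConst A l₁ k ≤ ENNReal.ofReal r) (x y : net.Act l₁) :
    net.patchNorm (l₁ + k) (net.sub A l₁ k x - net.sub A l₁ k y) ≤
      r * net.pixelNorm l₁ (x - y) := by
  set P := net.pixelNorm l₁ (x - y) with hP
  have hP0 : 0 ≤ P := net.pixelNorm_nonneg _ _
  refine le_of_forall_pos_le_add fun e he => ?_
  have hlt : net.lipConst A l₁ k < ENNReal.ofReal (r + e / (P + 1)) :=
    h.trans_lt ((ENNReal.ofReal_lt_ofReal_iff (by positivity)).2
      (lt_add_of_pos_right _ (by positivity)))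
  simp only [lipConst, iInf_lt_iff] at hlt
  obtain ⟨c, hc, hcr⟩ := hlt
  have hcr' : (c : ℝ) ≤ r + e / (P + 1) := by
    rw [← ENNReal.ofReal_coe_nnreal] at hcr
    exact ((ENNReal.ofReal_lt_ofReal_iff (by positivity)).1 hcr).le
  calc _ ≤ c * P := hc x y
    _ ≤ (r + e / (P + 1)) * P := mul_le_mul_of_nonneg_right hcr' hP0
    _ = r * P + e * (P / (P + 1)) := by ring
    _ ≤ r * P + e * 1 := by
        gcongr
        rw [div_le_one (by positivity)]
        linarith
    _ = _ := by ring

end Norms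

section Telescoping

variable {net}

theorem F_congr {A B : ∀ l, net.Wt l} {l : ℕ} (h : ∀ k < l, A k = B k) :
    net.F A l = net.F B l := by
  induction l with
  | zero => rfl
  | succ l ih =>
    ext1 x
    simp only [F]
    rw [ih fun k hk => h k (hk.trans (Nat.lt_succ_self l)), h l (Nat.lt_succ_self l)]

theorem sub_congr {A B : ∀ l, net.Wt l} {l₁ : ℕ} (h : ∀ l, l₁ ≤ l → A l = B l) (k : ℕ) :
    net.sub A l₁ k = net.sub B l₁ k := by
  induction k with
  | zero => rfl
  | succ k ih =>
    ext1 x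
    simp only [sub]
    rw [ih, h (l₁ + k) (Nat.le_add_right _ _)]

theorem F_add (A : ∀ l, net.Wt l) (l₁ k : ℕ) (x : net.Act 0) :
    net.F A (l₁ + k) x = net.sub A l₁ k (net.F A l₁ x) := by
  induction k with
  | zero => rfl
  | succ k ih =>
    change net.layer (l₁ + k) (A (l₁ + k)) (net.F A (l₁ + k) x) = _
    rw [ih]
    rfl

/-- The weights `B` below layer `j` and `A` from layer `j` on. -/
def mix (A B : ∀ l, net.Wt l) (j : ℕ) : ∀ l, net.Wt l := fun l => if l < j then B l else A l

/-- Errors made in the single layers propagate through the Lipschitz constants of `A`. -/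
theorem patchNorm_F_sub_F_le {A B : ∀ l, net.Wt l} {L : ℕ} {ρ : ℕ → ℕ → ℝ} {e : ℕ → ℝ}
    (hG : ∀ l < L, ∀ z z' : net.PreAct l,
      net.pixelNorm (l + 1) (net.G l z - net.G l z') ≤ net.channelNorm l (z - z'))
    (hρ : ∀ l₁ l₂, 1 ≤ l₁ → l₁ ≤ l₂ → l₂ ≤ L → 0 < ρ l₁ l₂)
    (hA : ∀ l₁ k : ℕ, 1 ≤ l₁ → l₁ + k ≤ L →
      net.lipConst A l₁ k ≤ ENNReal.ofReal (ρ l₁ (l₁ + k)))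
    (x : net.Act 0) {i : ℕ} (hi : i ≤ L)
    (he : ∀ l < i, net.channelNorm l
      (net.conv l (A l) (net.F B l x) - net.conv l (B l) (net.F B l x)) ≤ e l) :
    net.patchNorm i (net.F A i x - net.F B i x) ≤ ∑ l ∈ Finset.range i, ρ (l + 1) i * e l := by
  have h0 : net.F A i x = net.F (mix A B 0) i x := by
    rw [F_congr (A := A) (B := mix A B 0) fun k _ => by simp [mix]]
  have h1 : net.F B i x = net.F (mix A B i) i x := by
    rw [F_congr (A := B) (B := mix A B i) fun k hk => by simp [mix, hk]]
  rw [h0, h1, ← Finset.sum_range_sub' (fun j => net.F (mix A B j) i x)]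
  refine (net.patchNorm_sum_le i _ _).trans (Finset.sum_le_sum fun j hj => ?_)
  have hj' : j < i := Finset.mem_range.1 hj
  obtain ⟨k, rfl⟩ : ∃ k, i = j + 1 + k := ⟨i - (j + 1), by omega⟩
  have hsub : ∀ q, q ≤ j + 1 → net.sub (mix A B q) (j + 1) k = net.sub A (j + 1) k := fun q hq =>
    sub_congr (fun l hl => by simp [mix, show ¬ l < q by omega]) k
  have hF : ∀ q, j ≤ q → net.F (mix A B q) j x = net.F B j x := fun q hq => by
    rw [F_congr (A := mix A B q) (B := B) fun l hl => by simp [mix, show l < q by omega]]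
  rw [F_add (mix A B j) (j + 1) k, F_add (mix A B (j + 1)) (j + 1) k, hsub j (Nat.le_succ j),
    hsub (j + 1) le_rfl]
  refine (net.patchNorm_sub_le_of_lipConst_le (hρ (j + 1) (j + 1 + k) (by omega) (by omega) hi).le
    (hA (j + 1) k (by omega) hi) _ _).trans ?_
  refine mul_le_mul_of_nonneg_left ?_ (hρ (j + 1) (j + 1 + k) (by omega) (by omega) hi).le
  have e1 : net.F (mix A B j) (j + 1) x = net.G j (net.conv j (A j) (net.F B j x)) := by
    simp only [F, layer, hF j le_rfl]
    simp [mix]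
  have e2 : net.F (mix A B (j + 1)) (j + 1) x = net.G j (net.conv j (B j) (net.F B j x)) := by
    simp only [F, layer, hF (j + 1) (Nat.le_succ j)]
    simp [mix]
  rw [e1, e2]
  exact (hG j (by omega) _ _).trans (he j hj')

end Telescoping

section Covers

theorem exists_layer_cover (l : ℕ) {ι : Type*} [Fintype ι] (x : ι → net.Act l) {a c e : ℝ}
    (ha : 0 < a) (hc : 0 < c) (he : 0 < e) :
    ∃ C : Finset (net.Wt l), C.Nonempty ∧
      C.card ≤ (3 * (net.m (l + 1) * (Fintype.card ι * net.O l)) + 1) ^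
        ⌊4 * a ^ 2 * c ^ 2 / e ^ 2⌋₊ ∧
      ∀ A : net.Wt l, net.norm21 l A ≤ a → ∃ B ∈ C, ∀ i, net.patchNorm l (x i) ≤ c →
        net.channelNorm l (net.conv l A (x i) - net.conv l B (x i)) ≤ e := by
  classical
  set p : ι × Fin (net.O l) → EuclideanSpace ℝ (Fin (net.d (l + 1))) := fun q =>
    if net.patchNorm l (x q.1) ≤ c then net.patchVec l (x q.1) q.2 else 0 with hp
  have hpc : ∀ q, ‖p q‖ ≤ c := fun q => by
    simp only [hp]
    split_ifs with h
    · exact (net.norm_patchVec_le l _ _).trans h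
    · simpa using hc.le
  obtain ⟨C, hCne, hC, hCA⟩ := exists_matrix_cover (κ := Fin (net.m (l + 1))) p ha hc he hpc
  refine ⟨C.image fun B j i => B j i, hCne.image _, Finset.card_image_le.trans ?_, fun A hA => ?_⟩
  · simpa using hC
  obtain ⟨B, hB, r, hr0, hr, hBr⟩ := hCA (net.filterVec l A) (by rwa [← net.norm21_eq])
  refine ⟨_, Finset.mem_image_of_mem _ hB, fun i hi => ?_⟩
  refine (Real.sqrt_le_sqrt (y := ∑ j, r j ^ 2) (Finset.sum_le_sum fun j _ => ?_)).trans
    (Real.sqrt_le_iff.2 ⟨he.le, hr⟩)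
  refine pow_le_pow_left₀ (Real.iSup_nonneg fun o => abs_nonneg _) ?_ 2
  refine Real.iSup_le (fun o => ?_) (hr0 j)
  have h := hBr j (i, o)
  simp only [hp, hi, if_true] at h
  rw [inner_sub_left] at h
  rw [Pi.sub_apply, Pi.sub_apply, conv_eq_inner, conv_eq_inner]
  exact h

theorem exists_net_cover {ι : Type*} [Fintype ι] (s : ι → net.Act 0) (a c e : ℕ → ℝ) (L : ℕ)
    (ha : ∀ l < L, 0 < a l) (hc : ∀ l < L, 0 < c l) (he : ∀ l < L, 0 < e l) :
    ∃ D : Finset (∀ l, net.Wt l), D.Nonempty ∧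
      D.card ≤ ∏ l ∈ Finset.range L, (3 * (net.m (l + 1) * (Fintype.card ι * net.O l)) + 1) ^
        ⌊4 * a l ^ 2 * c l ^ 2 / e l ^ 2⌋₊ ∧
      ∀ A : ∀ l, net.Wt l, (∀ l < L, net.norm21 l (A l) ≤ a l) → ∃ B ∈ D, ∀ l < L, ∀ i,
        net.patchNorm l (net.F B l (s i)) ≤ c l → net.channelNorm l
          (net.conv l (A l) (net.F B l (s i)) - net.conv l (B l) (net.F B l (s i))) ≤ e l := by
  classical
  induction L with
  | zero => exact ⟨{0}, by simp, by simp, fun A _ => ⟨0, by simp, by simp⟩⟩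
  | succ L ih =>
    obtain ⟨D, hDne, hD, hDA⟩ := ih (fun l hl => ha l (by omega)) (fun l hl => hc l (by omega))
      fun l hl => he l (by omega)
    choose C hCne hC hCA using fun B : ∀ l, net.Wt l => net.exists_layer_cover L
      (fun i => net.F B L (s i)) (ha L (by omega)) (hc L (by omega)) (he L (by omega))
    refine ⟨D.biUnion fun B => (C B).image fun M => Function.update B L M, ?_, ?_, fun A hA => ?_⟩
    · obtain ⟨B, hB⟩ := hDne
      obtain ⟨M, hM⟩ := hCne B
      exact ⟨_, Finset.mem_biUnion.2 ⟨B, hB, Finset.mem_image_of_mem _ hM⟩⟩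
    · refine (Finset.card_biUnion_le_card_mul _ _ _ fun B _ =>
        Finset.card_image_le.trans (hC B)).trans ?_
      rw [Finset.prod_range_succ]
      exact Nat.mul_le_mul_right _ hD
    · obtain ⟨B, hB, hBA⟩ := hDA A fun l hl => hA l (by omega)
      obtain ⟨M, hM, hMA⟩ := hCA B (A L) (hA L (by omega))
      refine ⟨Function.update B L M, Finset.mem_biUnion.2
        ⟨B, hB, Finset.mem_image_of_mem _ hM⟩, fun l hl i => ?_⟩
      have hF : net.F (Function.update B L M) l = net.F B l :=
        F_congr fun k hk => Function.update_of_ne (by omega) _ _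
      rw [hF]
      rcases Nat.lt_succ_iff_lt_or_eq.1 hl with hl' | rfl
      · rw [Function.update_of_ne (by omega)]
        exact hBA l hl' i
      · rw [Function.update_self]
        exact hMA i

end Covers

end ConvNet

theorem continuous_iSup_of_finite {ι Y : Type*} [Finite ι] [TopologicalSpace Y] {f : ι → Y → ℝ}
    (hf : ∀ i, Continuous (f i)) : Continuous fun y => ⨆ i, f i y := by
  have := Fintype.ofFinite ι
  rcases isEmpty_or_nonempty ι with h | h
  · simp only [Real.iSup_of_isEmpty]
    exact continuous_const
  · simp_rw [← Finset.sup'_univ_eq_ciSup]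
    exact Continuous.finset_sup'_apply _ fun i _ => hf i

theorem abs_iSup_sub_iSup_le {ι : Type*} [Finite ι] [Nonempty ι] {f g : ι → ℝ} {e : ℝ}
    (h : ∀ i, |f i - g i| ≤ e) : |(⨆ i, f i) - ⨆ i, g i| ≤ e := by
  refine abs_sub_le_iff.2 ⟨?_, ?_⟩ <;> rw [sub_le_iff_le_add] <;> refine ciSup_le fun i => ?_
  · linarith [(abs_sub_le_iff.1 (h i)).1, le_iSup_of_finite g i]
  · linarith [(abs_sub_le_iff.1 (h i)).2, le_iSup_of_finite f i]

namespace ConvNet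

variable (net : ConvNet)

section Loss

/-- The ramp loss: it is `1` if the margin is at most `0` or if some activation is at least twice
as large as allowed by `b`, and it is `0` on `goodSet`. -/
noncomputable def loss (L : ℕ) (h : net.w L = 1) (b : ℕ → ℝ) (A : ∀ l, net.Wt l)
    (p : net.Act 0 × Fin (net.U L)) : ℝ :=
  min 1 (max 0 (max (1 - net.margin L h A p.1 p.2 / b L)
    (⨆ l : Fin (L + 1), (net.patchNorm l (net.F A l p.1) / b l - 1))))

variable {net} {L : ℕ} {h : net.w L = 1} {b : ℕ → ℝ} {A B : ∀ l, net.Wt l}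
  {p : net.Act 0 × Fin (net.U L)}

theorem loss_nonneg : 0 ≤ net.loss L h b A p := le_min zero_le_one (le_max_left _ _)

theorem loss_le_one : net.loss L h b A p ≤ 1 := min_le_left _ _

theorem loss_eq_one_of_misclassified (hb : ∀ l ≤ L, 0 < b l)
    (hp : p ∈ net.misclassified L h A) : net.loss L h b A p = 1 := by
  obtain ⟨c, hc, hle⟩ := hp
  have hm : net.margin L h A p.1 p.2 ≤ 0 := by
    have := le_iSup_of_finite (fun c : {c : Fin (net.U L) // c ≠ p.2} => net.score L h A p.1 c)
      ⟨c, hc⟩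
    simp only at this
    rw [margin]
    linarith
  have hm' : net.margin L h A p.1 p.2 / b L ≤ 0 :=
    div_nonpos_of_nonpos_of_nonneg hm (hb L le_rfl).le
  exact min_eq_left (le_max_of_le_right (le_max_of_le_left (by linarith)))

theorem loss_eq_one_of_le_patchNorm (hb : ∀ l ≤ L, 0 < b l) {l : ℕ} (hl : l ≤ L)
    (hp : 2 * b l ≤ net.patchNorm l (net.F A l p.1)) : net.loss L h b A p = 1 := by
  refine min_eq_left (le_max_of_le_right (le_max_of_le_right ?_))
  refine le_trans ?_ (le_iSup_of_finite
    (fun l : Fin (L + 1) => net.patchNorm l (net.F A l p.1) / b l - 1) ⟨l, by omega⟩)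
  simp only
  rw [le_sub_iff_add_le, le_div_iff₀ (hb l hl)]
  linarith

theorem loss_eq_zero_of_mem_goodSet (hb : ∀ l ≤ L, 0 < b l) {n : ℕ}
    {s : Fin n → net.Act 0 × Fin (net.U L)} {i : Fin n}
    (hi : i ∈ net.goodSet L h A b (b L) s) : net.loss L h b A (s i) = 0 := by
  obtain ⟨hm, hF⟩ := hi
  have h1 : 1 ≤ net.margin L h A (s i).1 (s i).2 / b L := by
    rw [le_div_iff₀ (hb L le_rfl)]
    linarith
  have h2 : (⨆ l : Fin (L + 1), (net.patchNorm l (net.F A l (s i).1) / b l - 1)) ≤ 0 :=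
    ciSup_le fun l => by
      have hl : (l : ℕ) ≤ L := by omega
      rw [sub_nonpos, div_le_one (hb l hl)]
      exact hF l hl
  rw [loss, max_eq_left (max_le (by linarith) h2)]
  simp

theorem abs_loss_sub_loss_le (hb : ∀ l ≤ L, 0 < b l) (hK : 2 ≤ net.U L)
    (hout : ∀ q : Fin (net.U L) × Fin (net.w L), ∃ o i, net.patch L o i = q) {ε : ℝ} (hε : 0 ≤ ε)
    (hAB : ∀ l ≤ L, net.patchNorm l (net.F A l p.1 - net.F B l p.1) ≤ ε / 2 * b l) :
    |net.loss L h b A p - net.loss L h b B p| ≤ ε := by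
  have hscore : ∀ c, |net.score L h A p.1 c - net.score L h B p.1 c| ≤ ε / 2 * b L := fun c => by
    refine le_trans ?_ (hAB L le_rfl)
    obtain ⟨o, i, hoi⟩ := hout (c, ⟨0, by omega⟩)
    have := net.abs_apply_le_patchNorm L (net.F A L p.1 - net.F B L p.1) o i
    rw [hoi] at this
    exact this
  have hne : Nonempty {c : Fin (net.U L) // c ≠ p.2} := by
    have : Nontrivial (Fin (net.U L)) := Fin.nontrivial_iff_two_le.2 hK
    obtain ⟨c, hc⟩ := exists_ne p.2
    exact ⟨⟨c, hc⟩⟩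
  have hmargin : |net.margin L h A p.1 p.2 - net.margin L h B p.1 p.2| ≤ ε * b L := by
    have h1 := hscore p.2
    have h2 := abs_iSup_sub_iSup_le fun c : {c : Fin (net.U L) // c ≠ p.2} => hscore c
    simp only [margin]
    rw [abs_le] at *
    constructor <;> linarith
  have hbL := hb L le_rfl
  have hramp : |(1 - net.margin L h A p.1 p.2 / b L) - (1 - net.margin L h B p.1 p.2 / b L)| ≤
      ε := by
    rw [sub_sub_sub_cancel_left, ← sub_div, abs_div, abs_of_pos hbL, div_le_iff₀ hbL, abs_sub_comm]
    exact hmargin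
  have hpatch : |(⨆ l : Fin (L + 1), (net.patchNorm l (net.F A l p.1) / b l - 1)) -
      ⨆ l : Fin (L + 1), (net.patchNorm l (net.F B l p.1) / b l - 1)| ≤ ε := by
    refine abs_iSup_sub_iSup_le fun l => ?_
    have hl : (l : ℕ) ≤ L := by omega
    rw [sub_sub_sub_cancel_right, ← sub_div, abs_div, abs_of_pos (hb l hl), div_le_iff₀ (hb l hl)]
    refine (net.abs_patchNorm_sub_le l _ _).trans ((hAB l hl).trans ?_)
    exact mul_le_mul_of_nonneg_right (by linarith) (hb l hl).le
  refine (abs_min_sub_min_le_max _ _ _ _).trans (max_le (by simpa using hε) ?_)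
  refine (abs_max_sub_max_le_max _ _ _ _).trans (max_le (by simpa using hε) ?_)
  exact (abs_max_sub_max_le_max _ _ _ _).trans (max_le hramp hpatch)

end Loss

section Continuity

variable {net} {L : ℕ}

theorem continuous_patchNorm (l : ℕ) : Continuous (net.patchNorm l) :=
  continuous_iSup_of_finite fun o => by fun_prop

theorem continuous_channelNorm (l : ℕ) : Continuous (net.channelNorm l) := by
  have : ∀ j, Continuous fun z : net.PreAct l => ⨆ o : Fin (net.O l), |z j o| := fun j =>
    continuous_iSup_of_finite fun o => by fun_prop
  unfold channelNorm
  fun_prop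

theorem channelNorm_zero (l : ℕ) : net.channelNorm l 0 = 0 := by
  simp [channelNorm]

theorem continuous_G {l : ℕ} (hG : ∀ z z' : net.PreAct l,
    net.pixelNorm (l + 1) (net.G l z - net.G l z') ≤ net.channelNorm l (z - z')) :
    Continuous (net.G l) := by
  refine continuous_pi fun u => continuous_pi fun v => continuous_iff_continuousAt.2 fun z => ?_
  rw [ContinuousAt, tendsto_iff_dist_tendsto_zero]
  have hlim : Filter.Tendsto (fun z' => net.channelNorm l (z' - z)) (nhds z) (nhds 0) := by
    have : Continuous fun z' => net.channelNorm l (z' - z) :=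
      (continuous_channelNorm l).comp (continuous_sub_right z)
    simpa [channelNorm_zero] using this.tendsto z
  refine squeeze_zero (fun _ => dist_nonneg) (fun z' => ?_) hlim
  exact (net.abs_apply_le_pixelNorm (l + 1) (net.G l z' - net.G l z) u v).trans (hG z' z)

theorem continuous_F (hG : ∀ l < L, ∀ z z' : net.PreAct l,
    net.pixelNorm (l + 1) (net.G l z - net.G l z') ≤ net.channelNorm l (z - z')) {l : ℕ}
    (hl : l ≤ L) : Continuous fun q : (∀ l, net.Wt l) × net.Act 0 => net.F q.1 l q.2 := by
  induction l with
  | zero => exact continuous_snd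
  | succ l ih =>
    have ih := ih (by omega)
    refine (continuous_G (hG l (by omega))).comp ?_
    refine continuous_pi fun j => continuous_pi fun o => ?_
    refine continuous_finsetSum _ fun i _ => ?_
    exact ((continuous_apply_apply _ _).comp ih).mul
      ((continuous_apply_apply j i).comp ((continuous_apply l).comp continuous_fst))

theorem continuous_loss (hG : ∀ l < L, ∀ z z' : net.PreAct l,
    net.pixelNorm (l + 1) (net.G l z - net.G l z') ≤ net.channelNorm l (z - z'))
    (h : net.w L = 1) (b : ℕ → ℝ) (y : Fin (net.U L)) :
    Continuous fun q : (∀ l, net.Wt l) × net.Act 0 => net.loss L h b q.1 (q.2, y) := by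
  have hscore : ∀ c, Continuous fun q : (∀ l, net.Wt l) × net.Act 0 => net.score L h q.1 q.2 c :=
    fun c => (continuous_apply_apply _ _).comp (continuous_F hG le_rfl)
  have hsup : Continuous fun q : (∀ l, net.Wt l) × net.Act 0 =>
      ⨆ c : {c : Fin (net.U L) // c ≠ y}, net.score L h q.1 q.2 c :=
    continuous_iSup_of_finite fun c => hscore c
  have hpatch : Continuous fun q : (∀ l, net.Wt l) × net.Act 0 =>
      ⨆ l : Fin (L + 1), (net.patchNorm l (net.F q.1 l q.2) / b l - 1) :=
    continuous_iSup_of_finite fun l =>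
      (((continuous_patchNorm l).comp (continuous_F hG (by omega))).div_const _).sub
        continuous_const
  exact continuous_const.min (continuous_const.max
    ((continuous_const.sub (((hscore y).sub hsup).div_const _)).max hpatch))

theorem measurable_loss (hG : ∀ l < L, ∀ z z' : net.PreAct l,
    net.pixelNorm (l + 1) (net.G l z - net.G l z') ≤ net.channelNorm l (z - z'))
    (h : net.w L = 1) (b : ℕ → ℝ) (A : ∀ l, net.Wt l) : Measurable (net.loss L h b A) :=
  measurable_from_prod_countable_left fun y =>
    ((continuous_loss hG h b y).comp (Continuous.prodMk_right A)).measurable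

end Continuity

end ConvNet

namespace ConvNet

variable {net : ConvNet} {L : ℕ}

theorem div_le_rhoPlus (ρ : ℕ → ℕ → ℝ) (b : ℕ → ℝ) {l i : ℕ} (hl : l ≤ i) (hi : i ≤ L) :
    ρ l i / b i ≤ rhoPlus L ρ b l :=
  le_iSup_of_finite (fun i : Set.Icc l L => ρ l i / b i) ⟨i, hl, hi⟩

theorem rhoPlus_pos {ρ : ℕ → ℕ → ℝ} {b : ℕ → ℝ} (hb : ∀ l ≤ L, 0 < b l)
    (hρ : ∀ l₁ l₂, 1 ≤ l₁ → l₁ ≤ l₂ → l₂ ≤ L → 0 < ρ l₁ l₂) {l : ℕ} (h1 : 1 ≤ l) (hl : l ≤ L) :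
    0 < rhoPlus L ρ b l :=
  (div_pos (hρ l l h1 le_rfl hl) (hb l hl)).trans_le (div_le_rhoPlus ρ b le_rfl hl)

theorem le_maxWidth {l : ℕ} (hl : l < L) : (net.O l : ℝ) * net.m (l + 1) ≤ net.maxWidth L :=
  le_iSup_of_finite (fun l : Fin L => (net.O l : ℝ) * net.m (l + 1)) ⟨l, hl⟩

theorem maxWidth_nonneg : 0 ≤ net.maxWidth L := Real.iSup_nonneg fun _ => by positivity

/-- If the activations of `B` are not too large, then the loss of `B` is close to the loss of `A`
as soon as the layers of `A` and `B` are close on the activations of `B`; and if they are too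
large, then both losses are `1`. -/
theorem abs_loss_sub_loss_le_of_layers {b : ℕ → ℝ} {ρ : ℕ → ℕ → ℝ} {A B : ∀ l, net.Wt l}
    {h : net.w L = 1} (hK : 2 ≤ net.U L)
    (hout : ∀ q : Fin (net.U L) × Fin (net.w L), ∃ o i, net.patch L o i = q)
    (hG : ∀ l < L, ∀ z z' : net.PreAct l,
      net.pixelNorm (l + 1) (net.G l z - net.G l z') ≤ net.channelNorm l (z - z'))
    (hb : ∀ l ≤ L, 0 < b l)
    (hρ : ∀ l₁ l₂, 1 ≤ l₁ → l₁ ≤ l₂ → l₂ ≤ L → 0 < ρ l₁ l₂)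
    (hA : ∀ l₁ k : ℕ, 1 ≤ l₁ → l₁ + k ≤ L →
      net.lipConst A l₁ k ≤ ENNReal.ofReal (ρ l₁ (l₁ + k)))
    {ε : ℝ} (hε : 0 ≤ ε) (hε1 : ε ≤ 1) {e : ℕ → ℝ} (he0 : ∀ l < L, 0 ≤ e l)
    (hsum : ∑ l ∈ Finset.range L, rhoPlus L ρ b (l + 1) * e l ≤ ε / 2)
    {p : net.Act 0 × Fin (net.U L)}
    (he : ∀ l < L, net.patchNorm l (net.F B l p.1) ≤ 5 / 2 * b l → net.channelNorm l
      (net.conv l (A l) (net.F B l p.1) - net.conv l (B l) (net.F B l p.1)) ≤ e l) :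
    |net.loss L h b A p - net.loss L h b B p| ≤ ε := by
  have hclose : ∀ i ≤ L, (∀ l < i, net.patchNorm l (net.F B l p.1) ≤ 5 / 2 * b l) →
      net.patchNorm i (net.F A i p.1 - net.F B i p.1) ≤ ε / 2 * b i := fun i hi hsmall => by
    refine (patchNorm_F_sub_F_le hG hρ hA p.1 hi
      fun l hl => he l (by omega) (hsmall l hl)).trans ?_
    have h1 : ∀ l < i, ρ (l + 1) i * e l ≤ rhoPlus L ρ b (l + 1) * e l * b i := fun l hl => by
      have := div_le_rhoPlus ρ b (l := l + 1) hl hi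
      rw [div_le_iff₀ (hb i hi)] at this
      calc _ ≤ rhoPlus L ρ b (l + 1) * b i * e l :=
            mul_le_mul_of_nonneg_right this (he0 l (by omega))
        _ = _ := by ring
    refine (Finset.sum_le_sum fun l hl => h1 l (Finset.mem_range.1 hl)).trans ?_
    rw [← Finset.sum_mul]
    refine mul_le_mul_of_nonneg_right (le_trans ?_ hsum) (hb i hi).le
    refine Finset.sum_le_sum_of_subset_of_nonneg
      (fun l hl => Finset.mem_range.2 ((Finset.mem_range.1 hl).trans_le hi)) fun l hl _ => ?_
    have hl' := Finset.mem_range.1 hl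
    exact mul_nonneg (rhoPlus_pos hb hρ (by omega) (by omega)).le (he0 l hl')
  by_cases hsmall : ∀ l < L, net.patchNorm l (net.F B l p.1) ≤ 5 / 2 * b l
  · exact abs_loss_sub_loss_le hb hK hout hε fun l hl =>
      hclose l hl fun k hk => hsmall k (by omega)
  · classical
    push Not at hsmall
    have hfind := Nat.find_spec hsmall
    set j := Nat.find hsmall with hj
    have hmin : ∀ l < j, net.patchNorm l (net.F B l p.1) ≤ 5 / 2 * b l := fun l hl => by
      by_contra hcon
      exact Nat.find_min hsmall hl ⟨by omega, not_le.1 hcon⟩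
    have hbj := hb j hfind.1.le
    have h1 := abs_le.1 ((net.abs_patchNorm_sub_le j _ _).trans (hclose j hfind.1.le hmin))
    have h2 : ε / 2 * b j ≤ 1 / 2 * b j := mul_le_mul_of_nonneg_right (by linarith) hbj.le
    rw [loss_eq_one_of_le_patchNorm hb hfind.1.le (A := A) (by linarith [h1.1, hfind.2]),
      loss_eq_one_of_le_patchNorm hb hfind.1.le (A := B) (by linarith [hfind.2])]
    simpa using hε

/-- A sup-norm cover of the losses on a sample. -/
theorem exists_loss_cover {a b : ℕ → ℝ} {ρ : ℕ → ℕ → ℝ} (hL : 0 < L)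
    (h : net.w L = 1) (hK : 2 ≤ net.U L)
    (hout : ∀ q : Fin (net.U L) × Fin (net.w L), ∃ o i, net.patch L o i = q)
    (hG : ∀ l < L, ∀ z z' : net.PreAct l,
      net.pixelNorm (l + 1) (net.G l z - net.G l z') ≤ net.channelNorm l (z - z'))
    (ha : ∀ l, 1 ≤ l → l ≤ L → 0 < a l) (hb : ∀ l ≤ L, 0 < b l)
    (hρ : ∀ l₁ l₂, 1 ≤ l₁ → l₁ ≤ l₂ → l₂ ≤ L → 0 < ρ l₁ l₂)
    {ε : ℝ} (hε : 0 < ε) (hε1 : ε ≤ 1) {n : ℕ} (s : Fin n → net.Act 0 × Fin (net.U L)) :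
    ∃ C : Finset (Fin n → ℝ),
      Real.log C.card ≤
        100 * capacity L a b ρ ^ 2 * Real.log (3 * (n * net.maxWidth L) + 1) / ε ^ 2 ∧
      ∀ A : ∀ l, net.Wt l, (∀ l < L, net.norm21 l (A l) ≤ a (l + 1)) →
        (∀ l₁ k : ℕ, 1 ≤ l₁ → l₁ + k ≤ L →
          net.lipConst A l₁ k ≤ ENNReal.ofReal (ρ l₁ (l₁ + k))) →
        ∃ t ∈ C, ∀ k, |net.loss L h b A (s k) - t k| ≤ ε := by
  classical
  obtain ⟨g, hg⟩ : ∃ g : ℕ → ℝ, ∀ l, g l =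
    (a (l + 1) * b l * rhoPlus L ρ b (l + 1)) ^ (2 / 3 : ℝ) := ⟨_, fun _ => rfl⟩
  have hrp : ∀ l < L, 0 < rhoPlus L ρ b (l + 1) := fun l hl =>
    rhoPlus_pos hb hρ (by omega) (by omega)
  have hr : ∀ l < L, 0 < a (l + 1) * b l * rhoPlus L ρ b (l + 1) := fun l hl =>
    mul_pos (mul_pos (ha _ (by omega) (by omega)) (hb l hl.le)) (hrp l hl)
  have hg0 : ∀ l < L, 0 < g l := fun l hl => by
    rw [hg]
    exact Real.rpow_pos_of_pos (hr l hl) _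
  have hg3 : ∀ l < L, g l ^ 3 = (a (l + 1) * b l * rhoPlus L ρ b (l + 1)) ^ 2 := fun l hl => by
    rw [hg, ← Real.rpow_natCast, ← Real.rpow_mul (hr l hl).le, ← Real.rpow_natCast]
    norm_num
  obtain ⟨S, hS⟩ : ∃ S : ℝ, S = ∑ l ∈ Finset.range L, g l := ⟨_, rfl⟩
  have hS0 : 0 < S := by
    rw [hS]
    exact Finset.sum_pos (fun l hl => hg0 l (Finset.mem_range.1 hl))
      (Finset.nonempty_range_iff.2 hL.ne')
  have hcap : capacity L a b ρ ^ 2 = S ^ 3 := by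
    have : capacity L a b ρ = S ^ (3 / 2 : ℝ) := by
      simp only [capacity, hS, hg]
    rw [this, ← Real.rpow_natCast, ← Real.rpow_mul hS0.le, ← Real.rpow_natCast]
    norm_num
  obtain ⟨e, he⟩ : ∃ e : ℕ → ℝ, ∀ l, e l = ε / 2 * (g l / S) / rhoPlus L ρ b (l + 1) :=
    ⟨_, fun _ => rfl⟩
  have he0 : ∀ l < L, 0 < e l := fun l hl => by
    rw [he]
    have := hg0 l hl
    have := hrp l hl
    positivity
  have hsteps : ∀ l < L, 4 * a (l + 1) ^ 2 * (5 / 2 * b l) ^ 2 / e l ^ 2 =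
      100 * S ^ 2 / ε ^ 2 * g l := fun l hl => by
    have h1 := hg0 l hl
    have h2 := hrp l hl
    rw [div_eq_iff (pow_pos (he0 l hl) 2).ne', he]
    field_simp
    linear_combination (-100) * hg3 l hl
  obtain ⟨D, hDne, hD, hDA⟩ := net.exists_net_cover (fun k => (s k).1) (fun l => a (l + 1))
    (fun l => 5 / 2 * b l) e L (fun l hl => ha _ (by omega) (by omega))
    (fun l hl => by have := hb l hl.le; positivity) he0
  refine ⟨D.image fun B k => net.loss L h b B (s k), ?_, fun A hA hlip => ?_⟩
  · have hpos : (0 : ℝ) < ((D.image fun B k => net.loss L h b B (s k)).card : ℝ) := by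
      exact_mod_cast Finset.card_pos.2 (hDne.image _)
    have hcard := (Finset.card_image_le (f := fun B k => net.loss L h b B (s k))).trans hD
    refine (Real.log_le_log hpos (Nat.cast_le.2 hcard)).trans ?_
    push_cast
    rw [Real.log_prod (fun l _ => by positivity)]
    have hW : ∀ l < L, 3 * ((net.m (l + 1) : ℝ) * (Fintype.card (Fin n) * net.O l)) + 1 ≤
        3 * (n * net.maxWidth L) + 1 := fun l hl => by
      have := mul_le_mul_of_nonneg_left (le_maxWidth (net := net) hl) (Nat.cast_nonneg (α := ℝ) n)
      simp only [Fintype.card_fin]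
      linarith
    have hterm : ∀ l ∈ Finset.range L,
        Real.log ((3 * ((net.m (l + 1) : ℝ) * (Fintype.card (Fin n) * net.O l)) + 1) ^
          ⌊4 * a (l + 1) ^ 2 * (5 / 2 * b l) ^ 2 / e l ^ 2⌋₊) ≤
        100 * S ^ 2 / ε ^ 2 * g l * Real.log (3 * (n * net.maxWidth L) + 1) := fun l hl => by
      have hl' := Finset.mem_range.1 hl
      rw [Real.log_pow, hsteps l hl']
      have := hg0 l hl'
      refine mul_le_mul (Nat.floor_le (by positivity))
        (Real.log_le_log (by positivity) (hW l hl')) (Real.log_nonneg ?_) (by positivity)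
      exact le_add_of_nonneg_left (by positivity)
    refine (Finset.sum_le_sum hterm).trans (le_of_eq ?_)
    rw [← Finset.sum_mul, ← Finset.mul_sum, ← hS, hcap]
    ring
  · obtain ⟨B, hB, hBA⟩ := hDA A hA
    refine ⟨_, Finset.mem_image_of_mem _ hB, fun k => ?_⟩
    refine abs_loss_sub_loss_le_of_layers hK hout hG hb hρ hlip hε.le hε1
      (fun l hl => (he0 l hl).le) (le_of_eq ?_) fun l hl => hBA l hl k
    calc _ = ∑ l ∈ Finset.range L, ε / 2 / S * g l := by
          refine Finset.sum_congr rfl fun l hl => ?_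
          have := hrp l (Finset.mem_range.1 hl)
          rw [he]
          field_simp
      _ = ε / 2 := by
          rw [← Finset.mul_sum, ← hS]
          field_simp

end ConvNet

/-- The chaining bound at the finest scale `2⁻ʲ` with `j = ⌊log₂ n⌋`. -/
theorem two_mul_chaining_bound_le {n : ℕ} (hn : 0 < n) {R W Γ : ℝ} (hR : 0 ≤ R) (hΓ : 0 ≤ Γ)
    (hW : W = 0 ∨ 1 ≤ W) :
    2 * ((2 ^ Nat.log 2 n)⁻¹ +
      Nat.log 2 n * (6 * √(100 * R ^ 2 * Real.log (3 * (n * W) + 1) / n))) ≤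
      8 / n + 1536 / √n * R * √(Real.logb 2 (32 * Γ * (n : ℝ) ^ 2 + 7 * W * n)) * Real.log n := by
  have hn1 : (1 : ℝ) ≤ n := by exact_mod_cast hn
  have hn' : (0 : ℝ) < n := by linarith
  have hW0 : 0 ≤ W := by rcases hW with h | h <;> linarith
  set Λ := Real.log (3 * (n * W) + 1) with hΛ
  set Λ' := Real.logb 2 (32 * Γ * (n : ℝ) ^ 2 + 7 * W * n) with hΛ'
  have hΛ0 : 0 ≤ Λ := Real.log_nonneg (le_add_of_nonneg_left (by positivity))
  have hlogn : 0 ≤ Real.log n := Real.log_nonneg hn1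
  have hΛΛ' : √Λ ≤ √Λ' := by
    rcases hW with h | h
    · have : Λ = 0 := by simp [hΛ, h]
      rw [this, Real.sqrt_zero]
      exact Real.sqrt_nonneg _
    · refine Real.sqrt_le_sqrt ?_
      have hnW : 1 ≤ n * W := one_le_mul_of_one_le_of_one_le hn1 h
      have hG : 0 ≤ 32 * Γ * (n : ℝ) ^ 2 := by positivity
      have hle : 3 * (n * W) + 1 ≤ 32 * Γ * (n : ℝ) ^ 2 + 7 * W * n := by nlinarith
      have h1 := Real.log_le_log (by positivity) hle
      rw [hΛ', Real.logb, le_div_iff₀ (Real.log_pos (by norm_num))]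
      calc Λ * Real.log 2 ≤ Λ * 1 :=
            mul_le_mul_of_nonneg_left (by linarith [Real.log_two_lt_d9]) hΛ0
        _ ≤ _ := by linarith
  have hpow : (2 ^ Nat.log 2 n : ℝ)⁻¹ ≤ 4 / n := by
    have : n < 2 ^ (Nat.log 2 n + 1) := Nat.lt_pow_succ_log_self (by norm_num) n
    have h2 : (n : ℝ) < 2 ^ (Nat.log 2 n + 1) := by exact_mod_cast this
    rw [pow_succ] at h2
    rw [inv_le_comm₀ (by positivity) (by positivity), inv_div]
    linarith
  have hJ : (Nat.log 2 n : ℝ) ≤ 2 * Real.log n := by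
    have : 2 ^ Nat.log 2 n ≤ n := Nat.pow_log_le_self 2 hn.ne'
    have h2 : (2 : ℝ) ^ Nat.log 2 n ≤ n := by exact_mod_cast this
    have h3 := Real.log_le_log (by positivity) h2
    rw [Real.log_pow] at h3
    have h4 : (Nat.log 2 n : ℝ) * (1 / 2) ≤ Nat.log 2 n * Real.log 2 :=
      mul_le_mul_of_nonneg_left (by linarith [Real.log_two_gt_d9]) (Nat.cast_nonneg _)
    linarith
  have hsqrt : √(100 * R ^ 2 * Λ / n) = 10 * R * √Λ / √n := by
    rw [show 100 * R ^ 2 * Λ / n = (10 * R) ^ 2 * (Λ / n) by ring, Real.sqrt_mul (by positivity),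
      Real.sqrt_sq (by positivity), Real.sqrt_div hΛ0]
    ring
  have hmain : (Nat.log 2 n : ℝ) * (6 * √(100 * R ^ 2 * Λ / n)) ≤
      2 * Real.log n * (6 * (10 * R * √Λ' / √n)) := by
    rw [hsqrt]
    gcongr
  have hlast : 2 * (2 * Real.log n * (6 * (10 * R * √Λ' / √n))) ≤
      1536 / √n * R * √Λ' * Real.log n := by
    have : 0 ≤ 1 / √n * R * √Λ' * Real.log n := by positivity
    calc _ = 240 * (1 / √n * R * √Λ' * Real.log n) := by ring
      _ ≤ 1536 * (1 / √n * R * √Λ' * Real.log n) := by linarith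
      _ = _ := by ring
  have h8 : (8 : ℝ) / n = 2 * (4 / n) := by ring
  rw [h8]
  linarith

namespace ConvNet

variable {net : ConvNet} {L : ℕ}

theorem maxWidth_eq_zero_or_one_le (hL : 0 < L) : net.maxWidth L = 0 ∨ 1 ≤ net.maxWidth L := by
  have : Nonempty (Fin L) := ⟨⟨0, hL⟩⟩
  obtain ⟨l, hl⟩ := exists_eq_ciSup_of_finite
    (f := fun l : Fin L => (net.O l : ℝ) * net.m (l + 1))
  rw [maxWidth, ← hl]
  rcases Nat.eq_zero_or_pos (net.O l * net.m (l + 1)) with h | h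
  · exact Or.inl (by exact_mod_cast h)
  · exact Or.inr (by exact_mod_cast h)

theorem gammaMax_nonneg {a b : ℕ → ℝ} {ρ : ℕ → ℕ → ℝ} (ha : ∀ l, 1 ≤ l → l ≤ L → 0 < a l)
    (hb : ∀ l ≤ L, 0 < b l) (hρ : ∀ l₁ l₂, 1 ≤ l₁ → l₁ ≤ l₂ → l₂ ≤ L → 0 < ρ l₁ l₂) :
    0 ≤ net.gammaMax L a b ρ :=
  Real.iSup_nonneg fun l => by
    have h1 := hb l (by omega)
    have h2 := ha (l + 1) (by omega) (by omega)
    have h3 := rhoPlus_pos hb hρ (l := l + 1) (by omega) (by omega)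
    positivity

theorem capacity_nonneg {a b : ℕ → ℝ} {ρ : ℕ → ℕ → ℝ} (ha : ∀ l, 1 ≤ l → l ≤ L → 0 < a l)
    (hb : ∀ l ≤ L, 0 < b l) (hρ : ∀ l₁ l₂, 1 ≤ l₁ → l₁ ≤ l₂ → l₂ ≤ L → 0 < ρ l₁ l₂) :
    0 ≤ capacity L a b ρ := by
  refine Real.rpow_nonneg (Finset.sum_nonneg fun l hl => Real.rpow_nonneg ?_ _) _
  have hl' := Finset.mem_range.1 hl
  have h1 := hb l (by omega)
  have h2 := ha (l + 1) (by omega) (by omega)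
  have h3 := rhoPlus_pos hb hρ (l := l + 1) (by omega) (by omega)
  positivity

theorem measureReal_misclassified_le (μ : Measure (net.Act 0 × Fin (net.U L)))
    [IsProbabilityMeasure μ] {h : net.w L = 1} {b : ℕ → ℝ} (hb : ∀ l ≤ L, 0 < b l)
    {A : ∀ l, net.Wt l} (hm : Measurable (net.loss L h b A)) :
    μ.real (net.misclassified L h A) ≤ ∫ p, net.loss L h b A p ∂μ := by
  have hint : Integrable (net.loss L h b A) μ := integrable_of_abs_le (M := 1) hm fun p =>
    abs_le.2 ⟨by linarith [loss_nonneg (net := net) (h := h) (b := b) (A := A) (p := p)],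
      loss_le_one⟩
  have := mul_meas_ge_le_integral_of_nonneg (ae_of_all μ fun p =>
    loss_nonneg (net := net) (h := h) (b := b) (A := A) (p := p)) hint 1
  rw [one_mul] at this
  exact (measureReal_mono fun p hp => (loss_eq_one_of_misclassified hb hp).ge).trans this

theorem sum_loss_le {h : net.w L = 1} {b : ℕ → ℝ} (hb : ∀ l ≤ L, 0 < b l) {A : ∀ l, net.Wt l}
    {n : ℕ} (s : Fin n → net.Act 0 × Fin (net.U L)) :
    ∑ k, net.loss L h b A (s k) ≤ n - (net.goodSet L h A b (b L) s).ncard := by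
  classical
  have hle : ∀ k, net.loss L h b A (s k) ≤
      1 - if k ∈ net.goodSet L h A b (b L) s then (1 : ℝ) else 0 := fun k => by
    split_ifs with hk
    · simp [loss_eq_zero_of_mem_goodSet hb hk]
    · simpa using loss_le_one
  refine (Finset.sum_le_sum fun k _ => hle k).trans (le_of_eq ?_)
  rw [Finset.sum_sub_distrib, Finset.sum_boole, Set.ncard_eq_toFinset_card']
  simp [Set.toFinset]

/-- The weights of a network that satisfy the norm constraints. -/
def admissible (net : ConvNet) (L : ℕ) (a : ℕ → ℝ) (ρ : ℕ → ℕ → ℝ) : Set (∀ l, net.Wt l) :=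
  {A | (∀ l < L, net.norm21 l (A l) ≤ a (l + 1)) ∧
    ∀ l₁ k : ℕ, 1 ≤ l₁ → l₁ + k ≤ L → net.lipConst A l₁ k ≤ ENNReal.ofReal (ρ l₁ (l₁ + k))}

/-- The uniform deviation bound for the losses of all admissible networks. -/
theorem measure_exists_loss_deviation_le {n : ℕ} (hL : 0 < L) (hn : 0 < n)
    (h : net.w L = 1) (hK : 2 ≤ net.U L)
    (hout : ∀ q : Fin (net.U L) × Fin (net.w L), ∃ o i, net.patch L o i = q)
    (hG : ∀ l < L, ∀ z z' : net.PreAct l,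
      net.pixelNorm (l + 1) (net.G l z - net.G l z') ≤ net.channelNorm l (z - z'))
    (μ : Measure (net.Act 0 × Fin (net.U L))) [IsProbabilityMeasure μ]
    {a b : ℕ → ℝ} {ρ : ℕ → ℕ → ℝ}
    (ha : ∀ l, 1 ≤ l → l ≤ L → 0 < a l) (hb : ∀ l ≤ L, 0 < b l)
    (hρ : ∀ l₁ l₂, 1 ≤ l₁ → l₁ ≤ l₂ → l₂ ≤ L → 0 < ρ l₁ l₂)
    {δ : ℝ} (hδ : 0 < δ) (hδ1 : δ ≤ 1) (J : ℕ) :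
    (Measure.pi fun _ : Fin n => μ)
      {s | ∃ A ∈ net.admissible L a ρ, (∑ k, net.loss L h b A (s k)) / n +
        2 * ((2 ^ J)⁻¹ + J * (6 * √(100 * capacity L a b ρ ^ 2 *
          Real.log (3 * (n * net.maxWidth L) + 1) / n))) +
        √(Real.log (1 / δ) / (2 * n)) < ∫ p, net.loss L h b A p ∂μ} ≤ ENNReal.ofReal δ := by
  rcases Set.eq_empty_or_nonempty (net.admissible L a ρ) with hemp | hne
  · simp [hemp]
  have : Nonempty (net.admissible L a ρ) := hne.to_subtype
  set q : ℝ := 2 * ((2 ^ J)⁻¹ + J * (6 * √(100 * capacity L a b ρ ^ 2 *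
          Real.log (3 * (n * net.maxWidth L) + 1) / n))) with hq
  set A : ℕ → net.admissible L a ρ := TopologicalSpace.denseSeq _ with hA
  have hm : ∀ A, Measurable (net.loss L h b A) := measurable_loss hG h b
  have hcont : ∀ p, Continuous fun A => net.loss L h b A p := fun p =>
    (continuous_loss hG h b p.2).comp (Continuous.prodMk_left p.1)
  have habs : ∀ A p, |net.loss L h b A p| ≤ 1 := fun A p =>
    abs_le.2 ⟨by linarith [loss_nonneg (net := net) (h := h) (b := b) (A := A) (p := p)],
      loss_le_one⟩
  have hint : Continuous fun A => ∫ p, net.loss L h b A p ∂μ :=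
    continuous_of_dominated (bound := fun _ => 1) (fun A => (hm A).aestronglyMeasurable)
      (fun A => ae_of_all _ (habs A)) (integrable_const _) (ae_of_all _ hcont)
  -- by continuity it suffices to consider a dense sequence of admissible weights
  set bad : ℕ → Set (Fin n → net.Act 0 × Fin (net.U L)) := fun N =>
    {s | ∃ i : Fin (N + 1), (∑ k, net.loss L h b (A i) (s k)) / n + q +
      √(Real.log (1 / δ) / (2 * n)) < ∫ p, net.loss L h b (A i) p ∂μ} with hbad
  have hmono : Monotone bad := fun N M hNM s hs => by
    obtain ⟨i, hi⟩ := hs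
    exact ⟨⟨i, by omega⟩, hi⟩
  refine (measure_mono (t := ⋃ N, bad N) ?_).trans ?_
  · rintro s ⟨A₀, hA₀, hlt⟩
    have hopen : IsOpen {B : net.admissible L a ρ | (∑ k, net.loss L h b B (s k)) / n + q +
        √(Real.log (1 / δ) / (2 * n)) < ∫ p, net.loss L h b B p ∂μ} := by
      refine isOpen_lt ?_ (hint.comp continuous_subtype_val)
      refine Continuous.add (Continuous.add (Continuous.div_const ?_ _) continuous_const)
        continuous_const
      exact continuous_finsetSum _ fun k _ => (hcont (s k)).comp continuous_subtype_val
    obtain ⟨N, hN⟩ := (TopologicalSpace.denseRange_denseSeq (net.admissible L a ρ)).exists_mem_open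
      hopen ⟨⟨A₀, hA₀⟩, hlt⟩
    exact Set.mem_iUnion.2 ⟨N, ⟨N, Nat.lt_succ_self N⟩, hN⟩
  · rw [hmono.measure_iUnion]
    refine iSup_le fun N => ?_
    refine measure_exists_deviation_le μ hn (fun i : Fin (N + 1) => net.loss L h b (A i))
      (fun i => hm _) (fun i p => loss_nonneg) (fun i p => loss_le_one) (fun s => ?_) hδ hδ1
    have hW : 0 ≤ (n : ℝ) * net.maxWidth L := mul_nonneg (Nat.cast_nonneg n) maxWidth_nonneg
    have hlog : 0 ≤ Real.log (3 * (n * net.maxWidth L) + 1) :=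
      Real.log_nonneg (by linarith)
    refine rademacherMean_le_of_covers hn _ (fun i k => loss_nonneg) (fun i k => loss_le_one)
      (by positivity) (fun j => ?_) J
    obtain ⟨C, hC, hCA⟩ := exists_loss_cover hL h hK hout hG ha hb hρ
      (ε := (2 ^ j : ℝ)⁻¹) (by positivity) (inv_le_one_of_one_le₀ (one_le_pow₀ (by norm_num))) s
    refine ⟨C, hC.trans (le_of_eq ?_), fun i => hCA _ (A i).2.1 (A i).2.2⟩
    rw [inv_pow, div_inv_eq_mul, ← pow_mul, mul_comm j 2, pow_mul]
    norm_num

end ConvNet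

/-- Generalisation bound for convolutional networks under fixed norm constraints.  There are
`K = net.U L` classes.  "With probability at least `1 - δ`" is stated as: the set of the samples
for which the conclusion fails has (outer) measure at most `δ`. -/
theorem conv_generalisation_fixed_norms
    (net : ConvNet) (L n : ℕ) (hL : 0 < L) (hn : 0 < n)
    -- the output layer has one spatial position and `K ≥ 2` channels
    (hwL : net.w L = 1) (hK : 2 ≤ net.U L)
    -- every class score belongs to some patch of the output layer, so that `|·|_L` is a norm
    (hout : ∀ q : Fin (net.U L) × Fin (net.w L), ∃ o i, net.patch L o i = q)
    -- the nonlinearities are 1-Lipschitz; this holds for channelwise maps that are 1-Lipschitz for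
    -- the sup norm (ReLU, spatial max pooling), and for 1-Lipschitz maps for the pixelwise norms
    (hG : ∀ l < L, ∀ z z' : net.PreAct l,
      net.pixelNorm (l + 1) (net.G l z - net.G l z') ≤ net.channelNorm l (z - z'))
    (μ : Measure (net.Act 0 × Fin (net.U L))) [IsProbabilityMeasure μ]
    (a b : ℕ → ℝ) (γ : ℝ) (ρ : ℕ → ℕ → ℝ)
    (ha : ∀ l, 1 ≤ l → l ≤ L → 0 < a l) (hb : ∀ l ≤ L, 0 < b l) (hγ : b L = γ)
    (hρ : ∀ l₁ l₂, 1 ≤ l₁ → l₁ ≤ l₂ → l₂ ≤ L → 0 < ρ l₁ l₂)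
    (hb0 : ∀ᵐ p ∂μ, net.patchNorm 0 p.1 ≤ b 0)
    (δ : ℝ) (hδ : 0 < δ) :
    (Measure.pi fun _ : Fin n => μ)
      {s : Fin n → net.Act 0 × Fin (net.U L) |
        ¬ ∀ A : ∀ l, net.Wt l,
          (∀ l < L, net.norm21 l (A l) ≤ a (l + 1)) →
          (∀ l₁ k : ℕ, 1 ≤ l₁ → l₁ + k ≤ L →
            net.lipConst A l₁ k ≤ ENNReal.ofReal (ρ l₁ (l₁ + k))) →
          μ.real (net.misclassified L hwL A) ≤
            ((n : ℝ) - (net.goodSet L hwL A b γ s).ncard) / n + 8 / n +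
            1536 / √n * ConvNet.capacity L a b ρ *
              √(Real.logb 2 (32 * net.gammaMax L a b ρ * (n : ℝ) ^ 2 + 7 * net.maxWidth L * n)) *
              Real.log n +
            3 * √(Real.log (2 / δ) / (2 * n))} ≤
      ENNReal.ofReal δ := by
  have hn' : (0 : ℝ) < n := by exact_mod_cast hn
  rcases lt_or_ge 1 δ with hδ1 | hδ1
  · exact prob_le_one.trans (by simpa using hδ1.le)
  subst hγ
  refine (measure_mono fun s hs => ?_).trans (ConvNet.measure_exists_loss_deviation_le hL hn hwL hK
    hout hG μ ha hb hρ hδ hδ1 (Nat.log 2 n))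
  by_contra hcon
  refine hs fun A hA hlip => ?_
  have hdev : ∫ p, net.loss L hwL b A p ∂μ ≤ _ := not_lt.1 fun hlt => hcon ⟨A, ⟨hA, hlip⟩, hlt⟩
  have hmis := ConvNet.measureReal_misclassified_le μ hb (ConvNet.measurable_loss hG hwL b A)
  have hemp := div_le_div_of_nonneg_right (ConvNet.sum_loss_le (h := hwL) hb (A := A) s) hn'.le
  have hcap := two_mul_chaining_bound_le hn (ConvNet.capacity_nonneg ha hb hρ)
    (ConvNet.gammaMax_nonneg (net := net) ha hb hρ)
    (ConvNet.maxWidth_eq_zero_or_one_le (net := net) hL)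
  have hconf : √(Real.log (1 / δ) / (2 * n)) ≤ 3 * √(Real.log (2 / δ) / (2 * n)) := by
    have hle : √(Real.log (1 / δ) / (2 * n)) ≤ √(Real.log (2 / δ) / (2 * n)) := by
      gcongr
      norm_num
    linarith [Real.sqrt_nonneg (Real.log (2 / δ) / (2 * n))]
  linarith
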